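/- Let 1<p<∞, 1<q≤∞, 0<β<1, and Λ≥2, and assume μ satisfies the quantitative reverse doubling condition for some exponent σ>βp. Let B⊂X be a ball, let E⊂closure(B) be a compact set, and let f=(f_n)_{n=n₀}^∞ be a sequence of nonnegative Borel functions on X such that L_β f(x) ≥ 1 for every x∈E. Then there exists a constant C=C(c_σ,p,q,σ,β,c_μ,Λ)>0 such that cap^β_{p,q}(E,2B,ΛB) ≤ C·‖f‖^p_{L^p(X;l^q)}. -/

import Mathlib

open MeasureTheory Metric Set
open scoped ENNReal NNReal

noncomputable section

namespace TLCap

variable {X : Type*} [MetricSpace X] [MeasurableSpace X] [BorelSpace X]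

/-- `validIdx X n` means `n ≥ n₀`, i.e. `2^{-n} ≤ 2 diam X`;
all `n : ℤ` are valid when `X` is unbounded. -/
def validIdx (X : Type*) [PseudoMetricSpace X] (n : ℤ) : Prop :=
  ENNReal.ofReal ((2 : ℝ) ^ (-n)) ≤ 2 * EMetric.diam (Set.univ : Set X)

/-- The doubling condition for `μ`, with doubling constant `c`. -/
def IsDoubling (μ : Measure X) (c : ℝ≥0∞) : Prop :=
  ∀ (x : X) (r : ℝ), 0 < r → μ (ball x (2 * r)) ≤ c * μ (ball x r)

/-- The reverse doubling condition with constant `c`. -/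
def IsReverseDoubling (μ : Measure X) (c : ℝ≥0∞) : Prop :=
  ∀ (x : X) (r : ℝ), 0 < r → 2 * ENNReal.ofReal r < EMetric.diam (Set.univ : Set X) →
    μ (ball x (r / 2)) ≤ c * μ (ball x r)

/-- The quantitative reverse doubling condition with exponent `σ` and constant `c`. -/
def IsQRD (μ : Measure X) (σ : ℝ) (c : ℝ≥0∞) : Prop :=
  ∀ (x : X) (r R : ℝ), 0 < r → r < R →
    ENNReal.ofReal R ≤ 2 * EMetric.diam (Set.univ : Set X) →
    μ (ball x r) ≤ c * ENNReal.ofReal ((r / R) ^ σ) * μ (ball x R)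

open Classical in
/-- The `l^q` norm of a sequence of extended nonnegative reals (`q = ∞` allowed). -/
def lqNorm (q : ℝ≥0∞) (a : ℤ → ℝ≥0∞) : ℝ≥0∞ :=
  if q = ∞ then ⨆ k, a k else (∑' k, a k ^ q.toReal) ^ (1 / q.toReal)

/-- The mixed norm `‖g‖_{L^p(Ω; l^q)}`. -/
def mixedNorm (μ : Measure X) (Ω : Set X) (p : ℝ) (q : ℝ≥0∞) (g : ℤ → X → ℝ≥0∞) : ℝ≥0∞ :=
  (∫⁻ x in Ω, lqNorm q (fun k => g k x) ^ p ∂μ) ^ (1 / p)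

/-- `g = (g_k)_{k ∈ ℤ}` is a fractional `β`-Hajłasz gradient of `u` on `Ω`. -/
def IsFracGrad (μ : Measure X) (β : ℝ) (Ω : Set X) (u : X → ℝ) (g : ℤ → X → ℝ≥0∞) : Prop :=
  (∀ k, Measurable (g k)) ∧
  ∃ N : Set X, N ⊆ Ω ∧ μ N = 0 ∧
    ∀ (k : ℤ), ∀ x ∈ Ω \ N, ∀ y ∈ Ω \ N,
      (2 : ℝ) ^ (-k - 1) ≤ dist x y → dist x y < (2 : ℝ) ^ (-k) →
      ENNReal.ofReal |u x - u y| ≤ ENNReal.ofReal (dist x y ^ β) * (g k x + g k y)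

/-- The homogeneous Hajłasz–Triebel–Lizorkin seminorm `|u|_{Ṁ^β_{p,q}(Ω)}`. -/
def htlSeminorm (μ : Measure X) (β p : ℝ) (q : ℝ≥0∞) (Ω : Set X) (u : X → ℝ) : ℝ≥0∞ :=
  ⨅ g : {g : ℤ → X → ℝ≥0∞ // IsFracGrad μ β Ω u g}, mixedNorm μ Ω p q g.1

/-- The relative Hajłasz–Triebel–Lizorkin capacity `cap^β_{p,q}(E, 2B, ΛB)`,
where `B = B(x₀, r)`. -/
def relCap (μ : Measure X) (β p : ℝ) (q : ℝ≥0∞) (E : Set X) (x₀ : X) (r Λ : ℝ) : ℝ≥0∞ :=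
  ⨅ φ : {φ : X → ℝ // Continuous φ ∧ (∀ x ∈ E, 1 ≤ φ x) ∧ ∀ x ∉ ball x₀ (2 * r), φ x = 0},
    htlSeminorm μ β p q (ball x₀ (Λ * r)) φ.1 ^ p

open Classical in
/-- The potential `H_β f`. -/
def Hpot (μ : Measure X) (β : ℝ) (f : ℤ → X → ℝ≥0∞) (x : X) : ℝ≥0∞ :=
  ∑' n : ℤ, if validIdx X n then
    (2 : ℝ≥0∞) ^ (-β * (n : ℝ)) *
      ∫⁻ y, (ball y ((2 : ℝ) ^ (-n))).indicator (fun _ => (1 : ℝ≥0∞)) x * f n y /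
        μ (ball y ((2 : ℝ) ^ (-n))) ∂μ
  else 0

/-- A sequence `(f_n)_{n ≥ n₀}` of nonnegative Borel functions, realized as a sequence
indexed by `ℤ` vanishing at invalid indices. -/
def IsAdmissibleSeq (f : ℤ → X → ℝ≥0∞) : Prop :=
  (∀ n, Measurable (f n)) ∧ ∀ n, ¬ validIdx X n → f n = 0

/-- The Triebel–Lizorkin `(β,p,q)`-capacity `Cp^β_{p,q}(E)`. -/
def CpCap (μ : Measure X) (β p : ℝ) (q : ℝ≥0∞) (E : Set X) : ℝ≥0∞ :=
  ⨅ f : {f : ℤ → X → ℝ≥0∞ // IsAdmissibleSeq f ∧ ∀ x ∈ E, 1 ≤ Hpot μ β f x},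
    mixedNorm μ Set.univ p q f.1 ^ p

open Classical in
/-- The sequence `Ȟ_β ν`. -/
def Hcheck (μ ν : Measure X) (β : ℝ) : ℤ → X → ℝ≥0∞ := fun n x =>
  if validIdx X n then
    (2 : ℝ≥0∞) ^ (-β * (n : ℝ)) * ν (ball x ((2 : ℝ) ^ (-n))) / μ (ball x ((2 : ℝ) ^ (-n)))
  else 0

/-- `ν` is a nonnegative Radon measure on the (compact) set `E`. -/
def IsRadonOn (ν : Measure X) (E : Set X) : Prop :=
  ν Eᶜ = 0 ∧ ν E ≠ ∞ ∧
  (∀ F : Set X, MeasurableSet F → F ⊆ E →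
    ν F = ⨅ (U : Set X) (_ : IsOpen U) (_ : F ⊆ U ∩ E), ν (U ∩ E)) ∧
  (∀ F : Set X, MeasurableSet F → F ⊆ E →
    ν F = ⨆ (K : Set X) (_ : IsCompact K) (_ : K ⊆ F), ν K)

open Classical in
/-- The conjugate exponent, with `1' = ∞` and `∞' = 1`. -/
def conjExp (q : ℝ≥0∞) : ℝ≥0∞ :=
  if q = 1 then ∞ else if q = ∞ then 1 else ENNReal.ofReal (q.toReal / (q.toReal - 1))

/-- `2^{-n₀}` (equal to `∞` when `X` is unbounded). -/
def radMax (X : Type*) [PseudoMetricSpace X] : ℝ≥0∞ :=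
  ⨆ (n : ℤ) (_ : validIdx X n), ENNReal.ofReal ((2 : ℝ) ^ (-n))

/-- The fractional maximal function `M_β ν`. -/
def fracMax (μ ν : Measure X) (β : ℝ) (x : X) : ℝ≥0∞ :=
  ⨆ (r : ℝ) (_ : 0 < r) (_ : ENNReal.ofReal r ≤ radMax X),
    ENNReal.ofReal (r ^ β) * ν (ball x r) / μ (ball x r)

/-- The Riesz potential `I_β ν` of a nonnegative Borel measure. -/
def rieszPot (μ ν : Measure X) (β : ℝ) (x : X) : ℝ≥0∞ :=
  ∫⁻ y in {x}ᶜ, ENNReal.ofReal (dist x y ^ β) / μ (ball x (dist x y)) ∂ν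

/-- The Riesz `(β,p)`-capacity `R_{β,p}(E)`. -/
def rieszCap (μ : Measure X) (β p : ℝ) (E : Set X) : ℝ≥0∞ :=
  ⨅ f : {f : X → ℝ≥0∞ // Measurable f ∧ ∀ x ∈ E, 1 ≤ rieszPot μ (μ.withDensity f) β x},
    ∫⁻ x, f.1 x ^ p ∂μ

/-- The `ρ`-restricted Hausdorff content of codimension `d`. -/
def hContent (μ : Measure X) (d : ℝ) (ρ : ℝ≥0∞) (F : Set X) : ℝ≥0∞ :=
  ⨅ c : {c : ℕ → X × ℝ //
      (∀ k, 0 < (c k).2 ∧ ENNReal.ofReal (c k).2 ≤ ρ) ∧ F ⊆ ⋃ k, ball (c k).1 (c k).2},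
    ∑' k, μ (ball (c.1 k).1 (c.1 k).2) * ENNReal.ofReal ((c.1 k).2 ^ (-d))

/-- Partition of unity data at every valid scale: the balls `B(x_{n,i}, 2^{-n-1})` are pairwise
disjoint, the balls `B(x_{n,i}, 2^{-n})` cover `X`, and `ψ_{n,i}` is the associated
partition of unity with constants `κ` and `L`. -/
def IsPartition {ι : ℤ → Type*} (pt : ∀ n, ι n → X)
    (ψ : ∀ n, ι n → X → ℝ) (κ L : ℝ) : Prop :=
  ∀ n : ℤ, validIdx X n →
    (∀ i j : ι n, i ≠ j →
        Disjoint (ball (pt n i) ((2:ℝ) ^ (-n - 1))) (ball (pt n j) ((2:ℝ) ^ (-n - 1)))) ∧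
    (∀ x : X, ∃ i : ι n, x ∈ ball (pt n i) ((2:ℝ) ^ (-n))) ∧
    (∀ (i : ι n) (x : X), 0 ≤ ψ n i x ∧ ψ n i x ≤ 1) ∧
    (∀ (i : ι n), ∀ x ∉ ball (pt n i) (6 * (2:ℝ) ^ (-n)), ψ n i x = 0) ∧
    (∀ (i : ι n), ∀ x ∈ ball (pt n i) (3 * (2:ℝ) ^ (-n)), κ ≤ ψ n i x) ∧
    (∀ i : ι n, LipschitzWith (Real.toNNReal ((2:ℝ) ^ n * L)) (ψ n i)) ∧
    (∀ x : X, HasSum (fun i : ι n => ψ n i x) 1)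

open Classical in
/-- The discrete potential `L_β f`. -/
def discPot {ι : ℤ → Type*} (μ : Measure X) (β : ℝ) (pt : ∀ n, ι n → X)
    (ψ : ∀ n, ι n → X → ℝ) (f : ℤ → X → ℝ≥0∞) (x : X) : ℝ≥0∞ :=
  ∑' n : ℤ, if validIdx X n then
    (2 : ℝ≥0∞) ^ (-β * (n : ℝ)) *
      ∑' i : ι n, ENNReal.ofReal (ψ n i x) *
        ((∫⁻ y in ball (pt n i) (3 * (2:ℝ) ^ (-n)), f n y ∂μ) /
          μ (ball (pt n i) (3 * (2:ℝ) ^ (-n))))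
  else 0

/-- A geodesic metric space: any two points are joined by an isometric image of an interval. -/
def IsGeodesicSpace (X : Type*) [MetricSpace X] : Prop :=
  ∀ x y : X, ∃ γ : ℝ → X, γ 0 = x ∧ γ (dist x y) = y ∧
    ∀ s ∈ Set.Icc (0:ℝ) (dist x y), ∀ t ∈ Set.Icc (0:ℝ) (dist x y),
      dist (γ s) (γ t) = |s - t|

/-- The Hajłasz–Triebel–Lizorkin `(β,p,q)`-capacity density condition with
constants `c₀, c₁, Λ`. -/
def HTLDensity (μ : Measure X) (β p : ℝ) (q : ℝ≥0∞) (E : Set X) (c₀ c₁ Λ : ℝ) : Prop :=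
  ∀ x ∈ E, ∀ r : ℝ, 0 < r → ENNReal.ofReal r < ENNReal.ofReal c₁ * EMetric.diam E →
    ENNReal.ofReal c₀ * relCap μ β p q (closure (ball x r)) x r Λ ≤
      relCap μ β p q (E ∩ closure (ball x r)) x r Λ

/-- The Riesz `(β,p)`-capacity density condition with constant `c₀`. -/
def RieszDensity (μ : Measure X) (β p : ℝ) (E : Set X) (c₀ : ℝ) : Prop :=
  ∀ x ∈ E, ∀ r : ℝ, 0 < r → ENNReal.ofReal (8 * r) < EMetric.diam E →
    ENNReal.ofReal c₀ * rieszCap μ β p (closure (ball x r)) ≤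
      rieszCap μ β p (E ∩ closure (ball x r))

/-- The Hausdorff content density condition of codimension `d` with constant `c₀`. -/
def HausdorffDensity (μ : Measure X) (d : ℝ) (E : Set X) (c₀ : ℝ) : Prop :=
  ∀ x ∈ E, ∀ r : ℝ, 0 < r → ENNReal.ofReal r < EMetric.diam E →
    ENNReal.ofReal c₀ * hContent μ d (ENNReal.ofReal r) (closure (ball x r)) ≤
      hContent μ d (ENNReal.ofReal r) (E ∩ closure (ball x r))

set_option linter.unusedSectionVars false

/-- A doubling measure together with a countable separated family of points at every dyadic
scale. -/
structure DoublingFamily (μ : Measure X) (c : ℝ≥0∞) {J : ℤ → Type*} (pt : ∀ n, J n → X) :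
    Prop where
  one_le : 1 ≤ c
  ne_top : c ≠ ∞
  doubling : IsDoubling μ c
  pos : ∀ (x : X) (r : ℝ), 0 < r → 0 < μ (ball x r)
  fin : ∀ (x : X) (r : ℝ), μ (ball x r) ≠ ∞
  disjoint : ∀ n (i j : J n), i ≠ j →
    Disjoint (ball (pt n i) ((2:ℝ) ^ (-n - 1))) (ball (pt n j) ((2:ℝ) ^ (-n - 1)))

/-- The ball of radius `6 · 2⁻ⁿ` around the `i`-th point of generation `n`. -/
def cell {J : ℤ → Type*} (pt : ∀ n, J n → X) (n : ℤ) (i : J n) : Set X :=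
  ball (pt n i) (6 * (2:ℝ) ^ (-n))

theorem measurableSet_cell {J : ℤ → Type*} (pt : ∀ n, J n → X) (n : ℤ) (i : J n) :
    MeasurableSet (cell pt n i) := measurableSet_ball

theorem IsDoubling.measure_ball_le {μ : Measure X} {c : ℝ≥0∞} (h : IsDoubling μ c) (x : X)
    {r R : ℝ} (j : ℕ) (hr : 0 < r) (hR : R ≤ 2 ^ j * r) :
    μ (ball x R) ≤ c ^ j * μ (ball x r) := by
  refine (measure_mono (ball_subset_ball hR)).trans ?_
  clear hR
  induction j with
  | zero => simp
  | succ j ih =>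
    have := h x (2 ^ j * r) (by positivity)
    calc μ (ball x (2 ^ (j + 1) * r)) = μ (ball x (2 * (2 ^ j * r))) := by ring_nf
      _ ≤ c * μ (ball x (2 ^ j * r)) := this
      _ ≤ c * (c ^ j * μ (ball x r)) := by gcongr
      _ = c ^ (j + 1) * μ (ball x r) := by ring

namespace DoublingFamily

variable {μ : Measure X} {c : ℝ≥0∞} {J : ℤ → Type*} {pt : ∀ n, J n → X}

theorem measure_cell_pos (h : DoublingFamily μ c pt) (n : ℤ) (i : J n) :
    μ (cell pt n i) ≠ 0 := (h.pos _ _ (by positivity)).ne'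

theorem measure_cell_ne_top (h : DoublingFamily μ c pt) (n : ℤ) (i : J n) :
    μ (cell pt n i) ≠ ∞ := h.fin _ _

theorem tsum_indicator_cell_le [∀ n, Countable (J n)] (h : DoublingFamily μ c pt) (n : ℤ) (x : X) :
    ∑' i, (cell pt n i).indicator (fun _ => (1 : ℝ≥0∞)) x ≤ c ^ 5 := by
  set ρ : ℝ := (2:ℝ) ^ (-n) with hρ
  have hρ0 : 0 < ρ := by positivity
  have hhalf : (2:ℝ) ^ (-n - 1) = ρ / 2 := by
    rw [zpow_sub_one₀ (by norm_num)]; rfl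
  have hm0 := (h.pos x (7 * ρ) (by positivity)).ne'
  have hmt := h.fin x (7 * ρ)
  have key : (∑' i, (cell pt n i).indicator (fun _ => (1 : ℝ≥0∞)) x) * μ (ball x (7 * ρ)) ≤
      c ^ 5 * μ (ball x (7 * ρ)) := by
    rw [← ENNReal.tsum_mul_right]
    calc ∑' i, (cell pt n i).indicator (fun _ => (1 : ℝ≥0∞)) x * μ (ball x (7 * ρ))
        ≤ ∑' i, c ^ 5 * μ (ball (pt n i) (ρ / 2) ∩ ball x (7 * ρ)) := by
          refine ENNReal.tsum_le_tsum fun i => ?_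
          by_cases hx : x ∈ cell pt n i
          · rw [indicator_of_mem hx, one_mul]
            have hx' : dist x (pt n i) < 6 * ρ := hx
            rw [inter_eq_left.2 (ball_subset_ball' ?_)]
            · refine (measure_mono (ball_subset_ball' ?_)).trans
                (h.doubling.measure_ball_le (pt n i) (R := 13 * ρ) 5 (half_pos hρ0) ?_)
              · linarith
              · linarith
            · rw [dist_comm]; linarith
          · simp [indicator_of_notMem hx]
      _ = c ^ 5 * ∑' i, μ (ball (pt n i) (ρ / 2) ∩ ball x (7 * ρ)) := ENNReal.tsum_mul_left
      _ ≤ c ^ 5 * μ (⋃ i, ball (pt n i) (ρ / 2) ∩ ball x (7 * ρ)) := by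
          gcongr
          refine tsum_meas_le_meas_iUnion_of_disjoint μ
            (fun i => measurableSet_ball.inter measurableSet_ball) fun i j hij => ?_
          have := h.disjoint n i j hij
          rw [hhalf] at this
          exact this.mono inter_subset_left inter_subset_left
      _ ≤ c ^ 5 * μ (ball x (7 * ρ)) := by
          gcongr
          exact iUnion_subset fun i => inter_subset_right
  exact (ENNReal.mul_le_mul_iff_left hm0 hmt).1 key

end DoublingFamily

/-- The measure with respect to which the averaging operator at `x` is an integral. -/
def avgMeasure (μ : Measure X) {J : ℤ → Type*} (pt : ∀ n, J n → X) (n : ℤ) (x : X) : Measure X :=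
  Measure.sum fun i =>
    ((cell pt n i).indicator (fun _ => (μ (cell pt n i))⁻¹) x) • μ.restrict (cell pt n i)

/-- The averaging operator of generation `n`. -/
def avgOp (μ : Measure X) {J : ℤ → Type*} (pt : ∀ n, J n → X) (n : ℤ) (f : X → ℝ≥0∞) (x : X) :
    ℝ≥0∞ := ∫⁻ y, f y ∂avgMeasure μ pt n x

/-- The maximal operator associated with the cells of all generations. -/
def maxOp (μ : Measure X) {J : ℤ → Type*} (pt : ∀ n, J n → X) (f : X → ℝ≥0∞) (x : X) : ℝ≥0∞ :=
  ⨆ (n : ℤ) (i : J n),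
    (cell pt n i).indicator (fun _ => (μ (cell pt n i))⁻¹ * ∫⁻ y in cell pt n i, f y ∂μ) x

section Operators

variable (μ : Measure X) {c : ℝ≥0∞} {J : ℤ → Type*} (pt : ∀ n, J n → X)

theorem avgOp_eq (n : ℤ) (f : X → ℝ≥0∞) (x : X) :
    avgOp μ pt n f x = ∑' i, (cell pt n i).indicator
      (fun _ => (μ (cell pt n i))⁻¹ * ∫⁻ y in cell pt n i, f y ∂μ) x := by
  rw [avgOp, avgMeasure, lintegral_sum_measure]
  refine tsum_congr fun i => ?_
  rw [lintegral_smul_measure]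
  by_cases hx : x ∈ cell pt n i <;> simp [hx]

theorem measurable_avgOp [∀ n, Countable (J n)] (n : ℤ) (f : X → ℝ≥0∞) :
    Measurable (avgOp μ pt n f) := by
  rw [funext (avgOp_eq μ pt n f)]
  exact Measurable.tsum fun i => measurable_const.indicator (measurableSet_cell pt n i)

theorem measurable_maxOp [∀ n, Countable (J n)] (f : X → ℝ≥0∞) : Measurable (maxOp μ pt f) :=
  Measurable.iSup fun n => Measurable.iSup fun i =>
    measurable_const.indicator (measurableSet_cell pt n i)

theorem avgOp_mono (n : ℤ) {f g : X → ℝ≥0∞} (hfg : f ≤ g) (x : X) :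
    avgOp μ pt n f x ≤ avgOp μ pt n g x := lintegral_mono hfg

theorem avgOp_rpow_mul_rpow_le (n : ℤ) {f g : X → ℝ≥0∞} (hf : Measurable f) (hg : Measurable g)
    {a b : ℝ} (ha : 0 ≤ a) (hb : 0 ≤ b) (hab : a + b = 1) (x : X) :
    avgOp μ pt n (fun y => f y ^ a * g y ^ b) x ≤ avgOp μ pt n f x ^ a * avgOp μ pt n g x ^ b :=
  ENNReal.lintegral_mul_norm_pow_le hf.aemeasurable hg.aemeasurable ha hb hab

theorem lintegral_mul_avgOp_eq_tsum [∀ n, Countable (J n)] (n : ℤ) (f : X → ℝ≥0∞)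
    {g : X → ℝ≥0∞} (hg : Measurable g) :
    ∫⁻ x, g x * avgOp μ pt n f x ∂μ = ∑' i, (μ (cell pt n i))⁻¹ *
      ((∫⁻ y in cell pt n i, f y ∂μ) * ∫⁻ y in cell pt n i, g y ∂μ) := by
  simp_rw [avgOp_eq, ← ENNReal.tsum_mul_left]
  rw [lintegral_tsum]
  swap
  · exact fun i => (hg.mul
      (measurable_const.indicator (measurableSet_cell pt n i))).aemeasurable
  refine tsum_congr fun i => ?_
  generalize ∫⁻ y in cell pt n i, f y ∂μ = I
  rw [← mul_assoc, ← lintegral_const_mul _ hg, ← lintegral_indicator (measurableSet_cell pt n i)]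
  refine lintegral_congr fun x => ?_
  by_cases hx : x ∈ cell pt n i <;> simp [hx, mul_comm]

theorem lintegral_mul_avgOp_comm [∀ n, Countable (J n)] (n : ℤ) {f g : X → ℝ≥0∞}
    (hf : Measurable f) (hg : Measurable g) :
    ∫⁻ x, g x * avgOp μ pt n f x ∂μ = ∫⁻ x, f x * avgOp μ pt n g x ∂μ := by
  rw [lintegral_mul_avgOp_eq_tsum μ pt n f hg, lintegral_mul_avgOp_eq_tsum μ pt n g hf]
  exact tsum_congr fun i => by rw [mul_comm (∫⁻ y in cell pt n i, f y ∂μ)]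

variable {μ pt}

theorem DoublingFamily.avgOp_le_maxOp [∀ n, Countable (J n)] (h : DoublingFamily μ c pt) (n : ℤ)
    (f : X → ℝ≥0∞) (x : X) : avgOp μ pt n f x ≤ c ^ 5 * maxOp μ pt f x := by
  rw [avgOp_eq]
  calc _ ≤ ∑' i, (cell pt n i).indicator (fun _ => (1 : ℝ≥0∞)) x * maxOp μ pt f x := by
        refine ENNReal.tsum_le_tsum fun i => ?_
        by_cases hx : x ∈ cell pt n i
        · rw [indicator_of_mem (f := fun _ => (1 : ℝ≥0∞)) hx, one_mul]
          exact le_iSup₂_of_le n i le_rfl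
        · simp [hx]
    _ = (∑' i, (cell pt n i).indicator (fun _ => (1 : ℝ≥0∞)) x) * maxOp μ pt f x :=
        ENNReal.tsum_mul_right
    _ ≤ _ := by gcongr; exact h.tsum_indicator_cell_le n x

theorem maxOp_le_add_const {f g : X → ℝ≥0∞} (hg : Measurable g) {a : ℝ≥0∞}
    (hfg : ∀ x, f x ≤ g x + a) (x : X) : maxOp μ pt f x ≤ maxOp μ pt g x + a := by
  refine iSup₂_le fun n i => ?_
  by_cases hx : x ∈ cell pt n i
  · calc _ = (μ (cell pt n i))⁻¹ * ∫⁻ y in cell pt n i, f y ∂μ := by simp [hx]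
      _ ≤ (μ (cell pt n i))⁻¹ * ∫⁻ y in cell pt n i, (g y + a) ∂μ := by gcongr; exact hfg _
      _ = (μ (cell pt n i))⁻¹ * ∫⁻ y in cell pt n i, g y ∂μ
          + a * ((μ (cell pt n i))⁻¹ * μ (cell pt n i)) := by
          rw [lintegral_add_left hg, setLIntegral_const]; ring
      _ ≤ maxOp μ pt g x + a * 1 := by
          gcongr
          · exact le_iSup₂_of_le n i (by simp [hx])
          · exact ENNReal.inv_mul_le_one _
      _ = _ := by rw [mul_one]
  · simp [hx]

end Operators

/-- The two-sided geometric weight `2 ^ (-δ|j|)`. -/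
def expWeight (δ : ℝ) (j : ℤ) : ℝ≥0∞ := (2 : ℝ≥0∞) ^ (-(δ * |(j : ℝ)|))

theorem tsum_expWeight_ne_top {δ : ℝ} (hδ : 0 < δ) : ∑' j, expWeight δ j ≠ ∞ := by
  have hlt : (2 : ℝ≥0∞) ^ (-δ) < 1 := by
    exact ENNReal.rpow_lt_one_of_one_lt_of_neg (by norm_num) (by linarith)
  have hgeo : ∑' n : ℕ, ((2 : ℝ≥0∞) ^ (-δ)) ^ n ≠ ∞ := by
    rw [ENNReal.tsum_geometric]
    simpa using tsub_pos_of_lt hlt |>.ne'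
  have hnat : ∀ n : ℕ, ((2 : ℝ≥0∞) ^ (-δ)) ^ n = (2 : ℝ≥0∞) ^ (-(δ * n)) := fun n => by
    rw [← ENNReal.rpow_natCast, ← ENNReal.rpow_mul, neg_mul]
  rw [tsum_of_nat_of_neg_add_one ENNReal.summable ENNReal.summable]
  refine ENNReal.add_ne_top.2 ⟨ne_top_of_le_ne_top hgeo (ENNReal.tsum_le_tsum fun n => ?_),
    ne_top_of_le_ne_top hgeo (ENNReal.tsum_le_tsum fun n => ?_)⟩
  · rw [hnat, expWeight]; simp
  · rw [hnat, expWeight]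
    refine ENNReal.rpow_le_rpow_of_exponent_le (by norm_num) ?_
    have : |((-((n : ℤ) + 1) : ℤ) : ℝ)| = n + 1 := by
      push_cast
      rw [abs_of_nonpos (by linarith [n.cast_nonneg (α := ℝ)])]; ring
    rw [this]; nlinarith

theorem tsum_expWeight_sub (δ : ℝ) (m : ℤ) :
    ∑' j, expWeight δ (j - m) = ∑' j, expWeight δ j :=
  (Equiv.subRight m).tsum_eq (expWeight δ)

theorem one_le_tsum_expWeight (δ : ℝ) : 1 ≤ ∑' j, expWeight δ j := by
  simpa [expWeight] using ENNReal.le_tsum (f := expWeight δ) 0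

theorem exists_two_rpow_lt_le {a : ℝ≥0∞} (h0 : a ≠ 0) (ht : a ≠ ∞) :
    ∃ n : ℤ, (2 : ℝ≥0∞) ^ (n : ℝ) < a ∧ a ≤ 2 ^ ((n : ℝ) + 1) := by
  obtain ⟨n, h1, h2⟩ := ENNReal.exists_mem_Ioc_zpow h0 ht (y := 2) (by norm_num) (by norm_num)
  refine ⟨n, by rwa [ENNReal.rpow_intCast], ?_⟩
  rw [show (n : ℝ) + 1 = ((n + 1 : ℤ) : ℝ) by push_cast; ring, ENNReal.rpow_intCast]
  exact h2

open Classical in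
theorem rpow_le_tsum_dyadic {p : ℝ} (hp : 0 < p) (a : ℝ≥0∞) :
    a ^ p ≤ ∑' j : ℤ, if (2 : ℝ≥0∞) ^ (j : ℝ) < a then (2 : ℝ≥0∞) ^ (((j : ℝ) + 1) * p) else 0 := by
  rcases eq_or_ne a 0 with rfl | h0
  · simp [hp]
  rcases eq_or_ne a ∞ with rfl | ht
  · have : ∀ j : ℕ, (1 : ℝ≥0∞) ≤ if (2 : ℝ≥0∞) ^ (((j : ℤ)) : ℝ) < ∞ then
        (2 : ℝ≥0∞) ^ (((((j : ℤ)) : ℝ) + 1) * p) else 0 := fun j => by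
      rw [if_pos (ENNReal.rpow_lt_top_of_nonneg (by positivity) (by norm_num))]
      exact ENNReal.one_le_rpow (by norm_num) (by positivity)
    have h2 := ENNReal.tsum_comp_le_tsum_of_injective (Nat.cast_injective (R := ℤ))
      (fun j : ℤ => if (2 : ℝ≥0∞) ^ (j : ℝ) < ∞ then (2 : ℝ≥0∞) ^ (((j : ℝ) + 1) * p) else 0)
    refine le_trans ?_ h2
    refine le_trans ?_ (ENNReal.tsum_le_tsum this)
    rw [ENNReal.tsum_const_eq_top_of_ne_zero one_ne_zero]
    exact le_top
  obtain ⟨n, h1, h2⟩ := exists_two_rpow_lt_le h0 ht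
  refine le_trans ?_ (ENNReal.le_tsum n)
  rw [if_pos h1, ENNReal.rpow_mul]
  gcongr

open Classical in
theorem tsum_dyadic_le {s : ℝ} (hs : 0 < s) (a : ℝ≥0∞) :
    (∑' j : ℤ, if (2 : ℝ≥0∞) ^ ((j : ℝ) - 1) < a then (2 : ℝ≥0∞) ^ ((j : ℝ) * s) else 0) ≤
      2 ^ s * (∑' j, expWeight s j) * a ^ s := by
  rcases eq_or_ne a 0 with rfl | h0
  · simp
  rcases eq_or_ne a ∞ with rfl | ht
  · rw [ENNReal.top_rpow_of_pos hs, ENNReal.mul_top]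
    · exact le_top
    · refine mul_ne_zero (ENNReal.rpow_pos (by norm_num) (by norm_num)).ne' ?_
      exact (zero_lt_one.trans_le (one_le_tsum_expWeight s)).ne'
  obtain ⟨n, h1, h2⟩ := exists_two_rpow_lt_le h0 ht
  calc _ ≤ ∑' j : ℤ, (2 : ℝ≥0∞) ^ (((n : ℝ) + 1) * s) * expWeight s (j - (n + 1)) := by
        refine ENNReal.tsum_le_tsum fun j => ?_
        split_ifs with hj
        · have hjn : (j : ℝ) - 1 < n + 1 := by
            by_contra! hcon
            exact absurd (hj.trans_le h2)
              (not_lt.2 (ENNReal.rpow_le_rpow_of_exponent_le (by norm_num) hcon))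
          have hjn' : j ≤ n + 1 := by
            have : ((j - 1 : ℤ) : ℝ) < ((n + 1 : ℤ) : ℝ) := by push_cast; exact hjn
            have := Int.cast_lt.1 this
            omega
          have : (j : ℝ) ≤ n + 1 := by exact_mod_cast hjn'
          rw [expWeight, ← ENNReal.rpow_add _ _ (by norm_num) (by norm_num)]
          refine ENNReal.rpow_le_rpow_of_exponent_le (by norm_num) ?_
          push_cast
          rw [abs_of_nonpos (by linarith)]
          apply le_of_eq; ring
        · exact zero_le
    _ = (2 : ℝ≥0∞) ^ (((n : ℝ) + 1) * s) * ∑' j, expWeight s j := by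
        rw [ENNReal.tsum_mul_left, tsum_expWeight_sub]
    _ = 2 ^ s * (∑' j, expWeight s j) * ((2 : ℝ≥0∞) ^ (n : ℝ)) ^ s := by
        rw [add_mul, one_mul, ENNReal.rpow_add _ _ (by norm_num) (by norm_num), ENNReal.rpow_mul]
        ring
    _ ≤ _ := by gcongr

section Maximal

variable {μ : Measure X} {c : ℝ≥0∞} {J : ℤ → Type*} {pt : ∀ n, J n → X} [∀ n, Countable (J n)]

theorem DoublingFamily.measure_lt_maxOp_le (h : DoublingFamily μ c pt) (f : X → ℝ≥0∞)
    {a : ℝ≥0∞} (ha0 : a ≠ 0) (hat : a ≠ ∞) :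
    μ {x | a < maxOp μ pt f x} ≤ c ^ 3 * a⁻¹ * ∫⁻ x, f x ∂μ := by
  let S : ℕ → Set (Σ n, J n) := fun N => {b | -(N : ℤ) ≤ b.1 ∧
    a < (μ (cell pt b.1 b.2))⁻¹ * ∫⁻ y in cell pt b.1 b.2, f y ∂μ}
  let A : ℕ → Set X := fun N => ⋃ b ∈ S N, cell pt b.1 b.2
  have hA : Monotone A := fun N M hNM => biUnion_subset_biUnion_left fun b hb =>
    ⟨le_trans (by simpa using hNM) hb.1, hb.2⟩
  have hsub : {x | a < maxOp μ pt f x} ⊆ ⋃ N, A N := fun x hx => by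
    obtain ⟨n, hn⟩ := lt_iSup_iff.1 (show a < maxOp μ pt f x from hx)
    obtain ⟨i, hi⟩ := lt_iSup_iff.1 hn
    have hxi : x ∈ cell pt n i := by
      by_contra hcon
      simp [hcon] at hi
    rw [indicator_of_mem hxi] at hi
    refine mem_iUnion.2 ⟨(-n).toNat, mem_biUnion (x := (⟨n, i⟩ : Σ n, J n)) ⟨?_, hi⟩ hxi⟩
    have := Int.self_le_toNat (-n)
    simp only
    linarith
  refine (measure_mono hsub).trans ?_
  rw [hA.measure_iUnion]
  refine iSup_le fun N => ?_
  obtain ⟨u, hut, hud, huc⟩ := Vitali.exists_disjoint_subfamily_covering_enlargement_closedBall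
    (S N) (fun b => pt b.1 b.2) (fun b => 6 * (2:ℝ) ^ (-b.1)) (6 * (2:ℝ) ^ (N : ℤ))
    (fun b hb => by
      gcongr
      · norm_num
      · linarith [hb.1]) 4 (by norm_num)
  have hcover : A N ⊆ ⋃ b ∈ u, ball (pt b.1 b.2) (8 * (6 * (2:ℝ) ^ (-b.1))) := by
    refine iUnion₂_subset fun b hb => ?_
    obtain ⟨b', hb', hbb⟩ := huc b hb
    refine subset_trans ?_ (subset_biUnion_of_mem hb')
    refine (ball_subset_closedBall.trans hbb).trans (closedBall_subset_ball ?_)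
    have : (0:ℝ) < 2 ^ (-b'.1) := by positivity
    linarith
  have hud' : u.PairwiseDisjoint fun b => cell pt b.1 b.2 := fun b hb b' hb' hne =>
    (hud hb hb' hne).mono ball_subset_closedBall ball_subset_closedBall
  calc μ (A N) ≤ μ (⋃ b ∈ u, ball (pt b.1 b.2) (8 * (6 * (2:ℝ) ^ (-b.1)))) := measure_mono hcover
    _ ≤ ∑' b : u, μ (ball (pt b.1.1 b.1.2) (8 * (6 * (2:ℝ) ^ (-b.1.1)))) :=
        measure_biUnion_le μ u.to_countable _
    _ ≤ ∑' b : u, c ^ 3 * a⁻¹ * ∫⁻ y in cell pt b.1.1 b.1.2, f y ∂μ := by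
        refine ENNReal.tsum_le_tsum fun b => ?_
        refine (h.doubling.measure_ball_le _ (r := 6 * (2:ℝ) ^ (-b.1.1)) 3 (by positivity)
          (by norm_num)).trans ?_
        rw [mul_assoc]
        gcongr
        have hlt := (hut b.2).2
        rw [mul_comm, ← div_eq_mul_inv] at hlt
        have := (ENNReal.le_div_iff_mul_le (Or.inl (h.measure_cell_pos _ _))
          (Or.inl (h.measure_cell_ne_top _ _))).1 hlt.le
        rw [mul_comm a⁻¹, ← div_eq_mul_inv,
          ENNReal.le_div_iff_mul_le (Or.inl ha0) (Or.inl hat), mul_comm]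
        exact this
    _ = c ^ 3 * a⁻¹ * ∫⁻ y in ⋃ b ∈ u, cell pt b.1 b.2, f y ∂μ := by
        rw [ENNReal.tsum_mul_left, lintegral_biUnion u.to_countable
          (fun b _ => measurableSet_cell pt b.1 b.2) hud']
    _ ≤ _ := by gcongr; exact Measure.restrict_le_self

theorem DoublingFamily.exists_lintegral_maxOp_rpow_le (h : DoublingFamily μ c pt) {p : ℝ}
    (hp : 1 < p) : ∃ C : ℝ≥0∞, C ≠ ∞ ∧ ∀ f : X → ℝ≥0∞, Measurable f →
      ∫⁻ x, maxOp μ pt f x ^ p ∂μ ≤ C * ∫⁻ x, f x ^ p ∂μ := by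
  classical
  have hs : 0 < p - 1 := by linarith
  refine ⟨c ^ 3 * 2 ^ (p + 1) * (2 ^ (p - 1) * ∑' j, expWeight (p - 1) j), ?_, fun f hf => ?_⟩
  · refine ENNReal.mul_ne_top (ENNReal.mul_ne_top (ENNReal.pow_ne_top h.ne_top) ?_)
      (ENNReal.mul_ne_top ?_ (tsum_expWeight_ne_top hs)) <;>
    exact ENNReal.rpow_ne_top_of_nonneg (by linarith) (by norm_num)
  have hset : ∀ j : ℤ, MeasurableSet {x | (2 : ℝ≥0∞) ^ ((j : ℝ) - 1) < f x} := fun j =>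
    measurableSet_lt measurable_const hf
  have hmset : ∀ j : ℤ, MeasurableSet {x | (2 : ℝ≥0∞) ^ (j : ℝ) < maxOp μ pt f x} := fun j =>
    measurableSet_lt measurable_const (measurable_maxOp μ pt f)
  have hweak : ∀ j : ℤ, μ {x | (2 : ℝ≥0∞) ^ (j : ℝ) < maxOp μ pt f x} ≤
      c ^ 3 * (2 ^ ((j : ℝ) - 1))⁻¹ *
        ∫⁻ x, {x | (2 : ℝ≥0∞) ^ ((j : ℝ) - 1) < f x}.indicator f x ∂μ := fun j => by
    refine (measure_mono fun x hx => ?_).trans (h.measure_lt_maxOp_le _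
      (ENNReal.rpow_pos (by norm_num) (by norm_num)).ne' (ENNReal.rpow_ne_top_of_ne_zero
        (by norm_num) (by norm_num)))
    have hle := maxOp_le_add_const (μ := μ) (pt := pt) (hf.indicator (hset j))
      (a := (2 : ℝ≥0∞) ^ ((j : ℝ) - 1)) (f := f) (fun y => by
        by_cases hy : (2 : ℝ≥0∞) ^ ((j : ℝ) - 1) < f y
        · rw [indicator_of_mem (by exact hy)]; exact le_self_add
        · exact le_add_left (not_lt.1 hy)) x
    have hx' : (2 : ℝ≥0∞) ^ (j : ℝ) < maxOp μ pt f x := hx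
    by_contra hcon
    refine absurd (hx'.trans_le hle) (not_lt.2 ?_)
    calc _ ≤ (2 : ℝ≥0∞) ^ ((j : ℝ) - 1) + (2 : ℝ≥0∞) ^ ((j : ℝ) - 1) := by
          gcongr; exact not_lt.1 hcon
      _ = (2 : ℝ≥0∞) ^ (1 : ℝ) * (2 : ℝ≥0∞) ^ ((j : ℝ) - 1) := by
          rw [ENNReal.rpow_one, two_mul]
      _ = (2 : ℝ≥0∞) ^ (j : ℝ) := by
          rw [← ENNReal.rpow_add _ _ (by norm_num) (by norm_num)]; ring_nf
  calc ∫⁻ x, maxOp μ pt f x ^ p ∂μ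
      ≤ ∫⁻ x, ∑' j : ℤ, {x | (2 : ℝ≥0∞) ^ (j : ℝ) < maxOp μ pt f x}.indicator
          (fun _ => (2 : ℝ≥0∞) ^ (((j : ℝ) + 1) * p)) x ∂μ := by
        refine lintegral_mono fun x => (rpow_le_tsum_dyadic (by linarith) _).trans (le_of_eq ?_)
        exact tsum_congr fun j => by simp [indicator]
    _ = ∑' j : ℤ, (2 : ℝ≥0∞) ^ (((j : ℝ) + 1) * p) *
          μ {x | (2 : ℝ≥0∞) ^ (j : ℝ) < maxOp μ pt f x} := by
        rw [lintegral_tsum fun j => (measurable_const.indicator (hmset j)).aemeasurable]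
        exact tsum_congr fun j => lintegral_indicator_const (hmset j) _
    _ ≤ ∑' j : ℤ, c ^ 3 * 2 ^ (p + 1) * ∫⁻ x, f x *
          {x | (2 : ℝ≥0∞) ^ ((j : ℝ) - 1) < f x}.indicator
            (fun _ => (2 : ℝ≥0∞) ^ ((j : ℝ) * (p - 1))) x ∂μ := by
        refine ENNReal.tsum_le_tsum fun j => ?_
        calc _ ≤ (2 : ℝ≥0∞) ^ (((j : ℝ) + 1) * p) * (c ^ 3 * (2 ^ ((j : ℝ) - 1))⁻¹ *
              ∫⁻ x, {x | (2 : ℝ≥0∞) ^ ((j : ℝ) - 1) < f x}.indicator f x ∂μ) := by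
              gcongr; exact hweak j
          _ = c ^ 3 * 2 ^ (p + 1) * (2 ^ ((j : ℝ) * (p - 1)) *
              ∫⁻ x, {x | (2 : ℝ≥0∞) ^ ((j : ℝ) - 1) < f x}.indicator f x ∂μ) := by
              have : (2 : ℝ≥0∞) ^ (((j : ℝ) + 1) * p) * (2 ^ ((j : ℝ) - 1))⁻¹ =
                  2 ^ (p + 1) * 2 ^ ((j : ℝ) * (p - 1)) := by
                rw [← ENNReal.rpow_neg, ← ENNReal.rpow_add _ _ (by norm_num) (by norm_num),
                  ← ENNReal.rpow_add _ _ (by norm_num) (by norm_num)]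
                ring_nf
              rw [← mul_assoc, ← mul_assoc, mul_comm _ (c ^ 3), mul_assoc (c ^ 3), this]
              ring
          _ = _ := by
              rw [← lintegral_const_mul _ (hf.indicator (hset j))]
              congr 1
              refine lintegral_congr fun x => ?_
              by_cases hx : (2 : ℝ≥0∞) ^ ((j : ℝ) - 1) < f x <;> simp [hx, mul_comm]
    _ = c ^ 3 * 2 ^ (p + 1) * ∫⁻ x, f x * ∑' j : ℤ,
          {x | (2 : ℝ≥0∞) ^ ((j : ℝ) - 1) < f x}.indicator
            (fun _ => (2 : ℝ≥0∞) ^ ((j : ℝ) * (p - 1))) x ∂μ := by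
        simp_rw [← ENNReal.tsum_mul_left (a := f _)]
        rw [ENNReal.tsum_mul_left, lintegral_tsum]
        exact fun j => (hf.mul (measurable_const.indicator (hset j))).aemeasurable
    _ ≤ c ^ 3 * 2 ^ (p + 1) * ∫⁻ x, (2 ^ (p - 1) * ∑' j, expWeight (p - 1) j) * f x ^ p ∂μ := by
        refine mul_le_mul' le_rfl (lintegral_mono fun x => ?_)
        calc _ ≤ f x * (2 ^ (p - 1) * (∑' j, expWeight (p - 1) j) * f x ^ (p - 1)) := by
              gcongr
              refine le_trans (le_of_eq ?_) (tsum_dyadic_le hs (f x))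
              exact tsum_congr fun j => by simp [indicator]
          _ = 2 ^ (p - 1) * (∑' j, expWeight (p - 1) j) * (f x ^ (1 : ℝ) * f x ^ (p - 1)) := by
              rw [ENNReal.rpow_one]; ring
          _ = _ := by
              rw [← ENNReal.rpow_add_of_nonneg _ _ (by norm_num) hs.le,
                add_sub_cancel]
    _ = _ := by rw [lintegral_const_mul _ (hf.pow_const p), mul_assoc (c ^ 3 * _)]

end Maximal

section VectorValued

theorem lintegral_rpow_le_of_duality {μ : Measure X} (hfin : ∀ (x : X) (r : ℝ), μ (ball x r) ≠ ∞)
    {p p' : ℝ} (hpp : p.HolderConjugate p') {G : X → ℝ≥0∞} (hG : Measurable G) {D : ℝ≥0∞}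
    (hD : ∀ g : X → ℝ≥0∞, Measurable g →
      ∫⁻ x, g x * G x ∂μ ≤ D * (∫⁻ x, g x ^ p' ∂μ) ^ (1 / p')) :
    ∫⁻ x, G x ^ p ∂μ ≤ D ^ p := by
  rcases isEmpty_or_nonempty X with hX | ⟨⟨x₀⟩⟩
  · simp [Measure.eq_zero_of_isEmpty μ]
  have hp := hpp.lt
  have hp0 : 0 < p := hpp.pos
  let T : ℕ → X → ℝ≥0∞ := fun m => (ball x₀ m).indicator fun x => min (G x) m
  have hTm : ∀ m, Measurable (T m) := fun m =>
    (hG.min measurable_const).indicator measurableSet_ball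
  have hTG : ∀ m x, T m x ≤ G x := fun m x =>
    indicator_le_self' (fun _ _ => zero_le) x |>.trans (min_le_left _ _)
  have hTbound : ∀ m, ∫⁻ x, T m x ^ p ∂μ ≤ D ^ p := fun m => by
    have hfinite : ∫⁻ x, T m x ^ p ∂μ ≠ ∞ := by
      refine ne_top_of_le_ne_top (b := (m : ℝ≥0∞) ^ p * μ (ball x₀ m))
        (ENNReal.mul_ne_top (ENNReal.rpow_ne_top_of_nonneg hp0.le (ENNReal.natCast_ne_top m))
          (hfin _ _)) ?_
      rw [← lintegral_indicator_const measurableSet_ball]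
      refine lintegral_mono fun x => ?_
      by_cases hx : x ∈ ball x₀ (m : ℝ)
      · simp only [T, indicator_of_mem hx]
        gcongr
        exact min_le_right _ _
      · simp [T, indicator_of_notMem hx, hp0]
    rcases eq_or_ne (∫⁻ x, T m x ^ p ∂μ) 0 with h0 | h0
    · rw [h0]; exact zero_le
    have hle : ∫⁻ x, T m x ^ p ∂μ ≤ D * (∫⁻ x, T m x ^ p ∂μ) ^ (1 / p') := by
      calc ∫⁻ x, T m x ^ p ∂μ ≤ ∫⁻ x, T m x ^ (p - 1) * G x ∂μ := by
            refine lintegral_mono fun x => ?_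
            calc T m x ^ p = T m x ^ (p - 1) * T m x ^ (1 : ℝ) := by
                  rw [← ENNReal.rpow_add_of_nonneg _ _ (by linarith) (by norm_num), sub_add_cancel]
              _ ≤ T m x ^ (p - 1) * G x := by
                  rw [ENNReal.rpow_one]; gcongr; exact hTG m x
        _ ≤ D * (∫⁻ x, (T m x ^ (p - 1)) ^ p' ∂μ) ^ (1 / p') := hD _ ((hTm m).pow_const _)
        _ = _ := by simp_rw [← ENNReal.rpow_mul, hpp.sub_one_mul_conj]
    have hroot : (∫⁻ x, T m x ^ p ∂μ) ^ (1 / p) ≤ D := by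
      have hA : (∫⁻ x, T m x ^ p ∂μ) ^ (1 / p') ≠ 0 := by
        simp [h0, hpp.symm.pos.not_gt, hfinite]
      have hA' : (∫⁻ x, T m x ^ p ∂μ) ^ (1 / p') ≠ ∞ :=
        ENNReal.rpow_ne_top_of_nonneg (one_div_nonneg.2 hpp.symm.nonneg) hfinite
      refine (ENNReal.mul_le_mul_iff_left hA hA').1 (le_trans (le_of_eq ?_) hle)
      rw [← ENNReal.rpow_add _ _ h0 hfinite, one_div, one_div, hpp.inv_add_inv_eq_one,
        ENNReal.rpow_one]
    calc ∫⁻ x, T m x ^ p ∂μ = ((∫⁻ x, T m x ^ p ∂μ) ^ (1 / p)) ^ p := by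
          rw [← ENNReal.rpow_mul, one_div_mul_cancel hp0.ne', ENNReal.rpow_one]
      _ ≤ D ^ p := by gcongr
  refine le_of_tendsto' (lintegral_tendsto_of_tendsto_of_monotone
    (fun m => ((hTm m).pow_const p).aemeasurable) (ae_of_all _ fun x m n hmn => ?_)
    (ae_of_all _ fun x => ?_)) hTbound
  · have hb : ball x₀ (m : ℝ) ⊆ ball x₀ (n : ℝ) := ball_subset_ball (by exact_mod_cast hmn)
    refine ENNReal.rpow_le_rpow ?_ hp0.le
    refine (indicator_le_indicator_of_subset hb (fun _ => zero_le) x).trans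
      (indicator_le_indicator ?_)
    gcongr
  · refine (ENNReal.continuous_rpow_const.tendsto _).comp ?_
    have hlim : Filter.Tendsto (fun m : ℕ => min (G x) (m : ℝ≥0∞)) Filter.atTop (nhds (G x)) := by
      simpa using tendsto_const_nhds.min ENNReal.tendsto_nat_nhds_top
    refine hlim.congr' ?_
    obtain ⟨M, hM⟩ := exists_nat_gt (dist x x₀)
    filter_upwards [Filter.eventually_ge_atTop M] with m hm
    have hx : x ∈ ball x₀ (m : ℝ) := hM.trans_le (by exact_mod_cast hm)
    simp only [T, indicator_of_mem hx]

variable {μ : Measure X} {c : ℝ≥0∞} {J : ℤ → Type*} {pt : ∀ n, J n → X} [∀ n, Countable (J n)]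

theorem DoublingFamily.exists_lintegral_tsum_avgOp_rpow_le (h : DoublingFamily μ c pt) {p : ℝ}
    (hp : 1 < p) : ∃ C : ℝ≥0∞, C ≠ ∞ ∧ ∀ f : ℤ → X → ℝ≥0∞, (∀ n, Measurable (f n)) →
      ∫⁻ x, (∑' n, avgOp μ pt n (f n) x) ^ p ∂μ ≤ C * ∫⁻ x, (∑' n, f n x) ^ p ∂μ := by
  obtain ⟨p', hpp⟩ : ∃ p', p.HolderConjugate p' := ⟨_, Real.HolderConjugate.conjExponent hp⟩
  obtain ⟨C, hC, hmax⟩ := h.exists_lintegral_maxOp_rpow_le hpp.symm.lt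
  refine ⟨(c ^ 5 * C ^ (1 / p')) ^ p, ENNReal.rpow_ne_top_of_nonneg hpp.nonneg
    (ENNReal.mul_ne_top (ENNReal.pow_ne_top h.ne_top)
      (ENNReal.rpow_ne_top_of_nonneg (one_div_nonneg.2 hpp.symm.nonneg) hC)), fun f hf => ?_⟩
  set F : X → ℝ≥0∞ := fun x => ∑' n, f n x with hF
  have hFm : Measurable F := Measurable.tsum hf
  have hdual : ∀ g : X → ℝ≥0∞, Measurable g →
      ∫⁻ x, g x * ∑' n, avgOp μ pt n (f n) x ∂μ ≤
        (c ^ 5 * C ^ (1 / p') * (∫⁻ x, F x ^ p ∂μ) ^ (1 / p)) *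
          (∫⁻ x, g x ^ p' ∂μ) ^ (1 / p') := fun g hg => by
    have hMg := measurable_maxOp μ pt g
    calc ∫⁻ x, g x * ∑' n, avgOp μ pt n (f n) x ∂μ
        = ∑' n, ∫⁻ x, g x * avgOp μ pt n (f n) x ∂μ := by
          simp_rw [← ENNReal.tsum_mul_left (a := g _)]
          exact lintegral_tsum fun n => (hg.mul (measurable_avgOp μ pt n (f n))).aemeasurable
      _ = ∑' n, ∫⁻ x, f n x * avgOp μ pt n g x ∂μ :=
          tsum_congr fun n => lintegral_mul_avgOp_comm μ pt n (hf n) hg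
      _ ≤ ∑' n, ∫⁻ x, f n x * (c ^ 5 * maxOp μ pt g x) ∂μ := by
          gcongr with n x
          exact h.avgOp_le_maxOp n g x
      _ = ∫⁻ x, c ^ 5 * (F x * maxOp μ pt g x) ∂μ := by
          rw [← lintegral_tsum]
          swap
          · exact fun n => ((hf n).mul (measurable_const.mul hMg)).aemeasurable
          refine lintegral_congr fun x => ?_
          rw [ENNReal.tsum_mul_right, mul_left_comm]
      _ = c ^ 5 * ∫⁻ x, (F * maxOp μ pt g) x ∂μ := lintegral_const_mul _ (hFm.mul hMg)
      _ ≤ c ^ 5 * ((∫⁻ x, F x ^ p ∂μ) ^ (1 / p) * (∫⁻ x, maxOp μ pt g x ^ p' ∂μ) ^ (1 / p')) := by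
          gcongr
          exact ENNReal.lintegral_mul_le_Lp_mul_Lq μ hpp hFm.aemeasurable hMg.aemeasurable
      _ ≤ c ^ 5 * ((∫⁻ x, F x ^ p ∂μ) ^ (1 / p) * (C * ∫⁻ x, g x ^ p' ∂μ) ^ (1 / p')) := by
          have := hpp.symm.pos
          gcongr
          exact hmax g hg
      _ = _ := by
          rw [ENNReal.mul_rpow_of_nonneg _ _ (one_div_nonneg.2 hpp.symm.nonneg)]; ring
  refine (lintegral_rpow_le_of_duality h.fin hpp
    (Measurable.tsum fun n => measurable_avgOp μ pt n (f n)) hdual).trans (le_of_eq ?_)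
  rw [ENNReal.mul_rpow_of_nonneg _ _ hpp.nonneg, ← ENNReal.rpow_mul _ (1 / p),
    one_div_mul_cancel hpp.ne_zero, ENNReal.rpow_one]

theorem lqNorm_top (a : ℤ → ℝ≥0∞) : lqNorm ∞ a = ⨆ k, a k := if_pos rfl

theorem lqNorm_of_ne_top {q : ℝ≥0∞} (hq : q ≠ ∞) (a : ℤ → ℝ≥0∞) :
    lqNorm q a = (∑' k, a k ^ q.toReal) ^ (1 / q.toReal) := if_neg hq

theorem measurable_lqNorm (q : ℝ≥0∞) {f : ℤ → X → ℝ≥0∞} (hf : ∀ n, Measurable (f n)) :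
    Measurable fun x => lqNorm q fun n => f n x := by
  rcases eq_or_ne q ∞ with rfl | hq
  · simp_rw [lqNorm_top]; exact Measurable.iSup hf
  · simp_rw [lqNorm_of_ne_top hq]
    exact (Measurable.tsum fun n => (hf n).pow_const _).pow_const _

theorem one_lt_toReal {q : ℝ≥0∞} (hq : 1 < q) (ht : q ≠ ∞) : 1 < q.toReal := by
  simpa using (ENNReal.toReal_lt_toReal ENNReal.one_ne_top ht).2 hq

theorem le_lqNorm {q : ℝ≥0∞} (hq : 1 < q) (a : ℤ → ℝ≥0∞) (k : ℤ) : a k ≤ lqNorm q a := by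
  rcases eq_or_ne q ∞ with rfl | ht
  · rw [lqNorm_top]; exact le_iSup a k
  have h0 : 0 < q.toReal := by linarith [one_lt_toReal hq ht]
  rw [lqNorm_of_ne_top ht]
  calc a k = (a k ^ q.toReal) ^ (1 / q.toReal) := by
        rw [← ENNReal.rpow_mul, mul_one_div_cancel h0.ne', ENNReal.rpow_one]
    _ ≤ _ := by gcongr; exact ENNReal.le_tsum (f := fun k => a k ^ q.toReal) k

/-- The vector-valued inequality for averaging operators. -/
theorem DoublingFamily.exists_lintegral_lqNorm_avgOp_rpow_le (h : DoublingFamily μ c pt) {p : ℝ}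
    (hp : 1 < p) {q : ℝ≥0∞} (hq : 1 < q) : ∃ C : ℝ≥0∞, C ≠ ∞ ∧
      ∀ f : ℤ → X → ℝ≥0∞, (∀ n, Measurable (f n)) →
        ∫⁻ x, lqNorm q (fun n => avgOp μ pt n (f n) x) ^ p ∂μ ≤
          C * ∫⁻ x, lqNorm q (fun n => f n x) ^ p ∂μ := by
  have hp0 : 0 < p := by linarith
  obtain ⟨C₁, hC₁, hmax⟩ := h.exists_lintegral_maxOp_rpow_le hp
  have hMF : ∀ F : X → ℝ≥0∞, Measurable F →
      ∫⁻ x, (c ^ 5 * maxOp μ pt F x) ^ p ∂μ ≤ (c ^ 5) ^ p * C₁ * ∫⁻ x, F x ^ p ∂μ := fun F hF => by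
    simp_rw [ENNReal.mul_rpow_of_nonneg _ _ hp0.le]
    rw [lintegral_const_mul _ ((measurable_maxOp μ pt F).pow_const p), mul_assoc]
    gcongr
    exact hmax F hF
  have hC₁' : (c ^ 5) ^ p * C₁ ≠ ∞ := ENNReal.mul_ne_top
    (ENNReal.rpow_ne_top_of_nonneg hp0.le (ENNReal.pow_ne_top h.ne_top)) hC₁
  rcases eq_or_ne q ∞ with rfl | ht
  · refine ⟨_, hC₁', fun f hf => ?_⟩
    refine le_trans (lintegral_mono fun x => ?_) (hMF _ (measurable_lqNorm ∞ hf))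
    refine ENNReal.rpow_le_rpow ?_ hp0.le
    rw [lqNorm_top]
    refine iSup_le fun n => (avgOp_mono μ pt n (fun y => ?_) x).trans (h.avgOp_le_maxOp n _ x)
    exact le_lqNorm hq (fun n => f n y) n
  obtain ⟨C₂, hC₂, hsum⟩ := h.exists_lintegral_tsum_avgOp_rpow_le hp
  have hs := one_lt_toReal hq ht
  set s := q.toReal
  have hs0 : 0 < s := by linarith
  have hinv : 0 ≤ 1 - 1 / s := by
    rw [sub_nonneg, div_le_one hs0]; exact hs.le
  refine ⟨max C₂ ((c ^ 5) ^ p * C₁), max_lt hC₂.lt_top hC₁'.lt_top |>.ne, fun f hf => ?_⟩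
  set F : X → ℝ≥0∞ := fun x => lqNorm q fun n => f n x with hF
  have hFm : Measurable F := measurable_lqNorm q hf
  have hFs : ∀ x, F x ^ s = ∑' n, f n x ^ s := fun x => by
    rw [hF]
    simp only
    rw [lqNorm_of_ne_top ht, ← ENNReal.rpow_mul, one_div_mul_cancel hs0.ne', ENNReal.rpow_one]
  let g : ℤ → X → ℝ≥0∞ := fun n =>
    {x | F x = ∞}.piecewise (fun _ => ∞) fun x => f n x ^ s * F x ^ (1 - s)
  have hgm : ∀ n, Measurable (g n) := fun n => Measurable.piecewise
    (hFm (measurableSet_singleton ∞)) measurable_const (((hf n).pow_const _).mul (hFm.pow_const _))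
  have hgsum : ∀ x, ∑' n, g n x ≤ F x := fun x => by
    by_cases hx : F x = ∞
    · rw [hx]; exact le_top
    have : ∀ n, g n x = f n x ^ s * F x ^ (1 - s) := fun n => piecewise_eq_of_notMem _ _ _ hx
    simp_rw [this]
    rw [ENNReal.tsum_mul_right, ← hFs]
    rcases eq_or_ne (F x) 0 with h0 | h0
    · simp [h0, hs0]
    · rw [← ENNReal.rpow_add _ _ h0 hx]; simp
  have hfg : ∀ n x, f n x ≤ g n x ^ (1 / s) * F x ^ (1 - 1 / s) := fun n x => by
    by_cases hx : F x = ∞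
    · have : g n x = ∞ := piecewise_eq_of_mem _ _ _ hx
      have h1 : 0 < 1 - 1 / s := by
        rw [sub_pos, div_lt_one hs0]; exact hs
      rw [this, hx, ENNReal.top_rpow_of_pos h1, ENNReal.top_rpow_of_pos (by positivity)]
      simp
    have hgx : g n x = f n x ^ s * F x ^ (1 - s) := piecewise_eq_of_notMem _ _ _ hx
    rcases eq_or_ne (F x) 0 with h0 | h0
    · refine (le_lqNorm hq (fun n => f n x) n).trans ?_
      rw [show lqNorm q (fun n => f n x) = 0 from h0]; exact zero_le
    · rw [hgx, ENNReal.mul_rpow_of_nonneg _ _ (by positivity), ← ENNReal.rpow_mul,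
        ← ENNReal.rpow_mul, mul_assoc, ← ENNReal.rpow_add _ _ h0 hx, mul_one_div_cancel hs0.ne',
        ENNReal.rpow_one]
      rw [show (1 - s) * (1 / s) + (1 - 1 / s) = 0 by field_simp; ring]
      simp
  set G : X → ℝ≥0∞ := fun x => ∑' n, avgOp μ pt n (g n) x with hG
  have hpoint : ∀ x, lqNorm q (fun n => avgOp μ pt n (f n) x) ^ p ≤
      (G x ^ p) ^ (1 / s) * ((c ^ 5 * maxOp μ pt F x) ^ p) ^ (1 - 1 / s) := fun x => by
    have h1 : ∀ n, avgOp μ pt n (f n) x ^ s ≤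
        avgOp μ pt n (g n) x * (c ^ 5 * maxOp μ pt F x) ^ ((1 - 1 / s) * s) := fun n => by
      calc avgOp μ pt n (f n) x ^ s
          ≤ (avgOp μ pt n (g n) x ^ (1 / s) * (c ^ 5 * maxOp μ pt F x) ^ (1 - 1 / s)) ^ s := by
            refine ENNReal.rpow_le_rpow ?_ hs0.le
            refine (avgOp_mono μ pt n (hfg n) x).trans ((avgOp_rpow_mul_rpow_le μ pt n (hgm n) hFm
              (by positivity) hinv (by ring) x).trans ?_)
            gcongr
            exact h.avgOp_le_maxOp n F x
        _ = _ := by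
            rw [ENNReal.mul_rpow_of_nonneg _ _ hs0.le, ← ENNReal.rpow_mul, ← ENNReal.rpow_mul,
              one_div_mul_cancel hs0.ne', ENNReal.rpow_one]
    rw [lqNorm_of_ne_top ht]
    calc ((∑' n, avgOp μ pt n (f n) x ^ s) ^ (1 / s)) ^ p
        ≤ ((G x * (c ^ 5 * maxOp μ pt F x) ^ ((1 - 1 / s) * s)) ^ (1 / s)) ^ p := by
          gcongr
          rw [hG]
          simp only
          rw [← ENNReal.tsum_mul_right]
          exact ENNReal.tsum_le_tsum h1
      _ = _ := by
          rw [ENNReal.mul_rpow_of_nonneg _ _ (by positivity), ENNReal.mul_rpow_of_nonneg _ _ hp0.le]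
          simp_rw [← ENNReal.rpow_mul]
          congr 2
          · ring
          · field_simp
  have hGm : Measurable G := Measurable.tsum fun n => measurable_avgOp μ pt n (g n)
  have hGle : ∫⁻ x, G x ^ p ∂μ ≤ C₂ * ∫⁻ x, F x ^ p ∂μ := by
    refine (hsum g hgm).trans ?_
    gcongr
    exact hgsum _
  set I := ∫⁻ x, F x ^ p ∂μ with hI
  calc _ ≤ ∫⁻ x, (G x ^ p) ^ (1 / s) * ((c ^ 5 * maxOp μ pt F x) ^ p) ^ (1 - 1 / s) ∂μ :=
        lintegral_mono hpoint
    _ ≤ (∫⁻ x, G x ^ p ∂μ) ^ (1 / s) * (∫⁻ x, (c ^ 5 * maxOp μ pt F x) ^ p ∂μ) ^ (1 - 1 / s) :=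
        ENNReal.lintegral_mul_norm_pow_le (hGm.pow_const p).aemeasurable
          ((measurable_const.mul (measurable_maxOp μ pt F)).pow_const p).aemeasurable
          (by positivity) hinv (by ring)
    _ ≤ (max C₂ ((c ^ 5) ^ p * C₁) * I) ^ (1 / s) *
          (max C₂ ((c ^ 5) ^ p * C₁) * I) ^ (1 - 1 / s) := by
        gcongr
        · exact hGle.trans (by gcongr; exact le_max_left _ _)
        · exact (hMF F hFm).trans (by gcongr; exact le_max_right _ _)
    _ = _ := by
        rw [← ENNReal.rpow_add_of_nonneg _ _ (by positivity) hinv, add_sub_cancel, ENNReal.rpow_one]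

end VectorValued

section SequenceNorms

variable {q : ℝ≥0∞}

theorem lqNorm_add_le (hq : 1 < q) (a b : ℤ → ℝ≥0∞) :
    lqNorm q (fun k => a k + b k) ≤ lqNorm q a + lqNorm q b := by
  rcases eq_or_ne q ∞ with rfl | ht
  · simp_rw [lqNorm_top]
    exact iSup_le fun k => add_le_add (le_iSup a k) (le_iSup b k)
  simp_rw [lqNorm_of_ne_top ht, ← lintegral_count]
  exact ENNReal.lintegral_Lp_add_le (Measurable.of_discrete).aemeasurable
    (Measurable.of_discrete).aemeasurable (one_lt_toReal hq ht).le

theorem lqNorm_const_mul_le (hq : 1 < q) (C : ℝ≥0∞) (a : ℤ → ℝ≥0∞) :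
    lqNorm q (fun k => C * a k) ≤ C * lqNorm q a := by
  rcases eq_or_ne q ∞ with rfl | ht
  · simp_rw [lqNorm_top]
    exact iSup_le fun k => by gcongr; exact le_iSup a k
  have hs := one_lt_toReal hq ht
  simp_rw [lqNorm_of_ne_top ht]
  simp_rw [ENNReal.mul_rpow_of_nonneg C _ (by linarith : 0 ≤ q.toReal)]
  rw [ENNReal.tsum_mul_left, ENNReal.mul_rpow_of_nonneg _ _ (by positivity), ← ENNReal.rpow_mul,
    mul_one_div_cancel (by linarith), ENNReal.rpow_one]

theorem lqNorm_le_tsum (hq : 1 < q) (a : ℤ → ℝ≥0∞) : lqNorm q a ≤ ∑' k, a k := by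
  rcases eq_or_ne q ∞ with rfl | ht
  · rw [lqNorm_top]
    exact iSup_le fun k => ENNReal.le_tsum k
  have hs := one_lt_toReal hq ht
  rw [lqNorm_of_ne_top ht]
  set s := q.toReal
  set A := ∑' k, a k with hA
  have hsplit : ∀ b : ℝ≥0∞, b ^ s = b ^ (s - 1) * b := fun b => by
    nth_rw 3 [← ENNReal.rpow_one b]
    rw [← ENNReal.rpow_add_of_nonneg _ _ (by linarith) (by norm_num), sub_add_cancel]
  have hle : ∑' k, a k ^ s ≤ A ^ s := by
    calc ∑' k, a k ^ s ≤ ∑' k, A ^ (s - 1) * a k := by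
          refine ENNReal.tsum_le_tsum fun k => ?_
          rw [hsplit (a k)]
          have : 0 ≤ s - 1 := by linarith
          gcongr
          exact ENNReal.le_tsum k
      _ = A ^ s := by rw [ENNReal.tsum_mul_left, ← hA, ← hsplit]
  calc _ ≤ (A ^ s) ^ (1 / s) := by gcongr
    _ = A := by rw [← ENNReal.rpow_mul, mul_one_div_cancel (by linarith), ENNReal.rpow_one]

/-- Young's convolution inequality on `ℤ`. -/
theorem lqNorm_conv_le (hq : 1 < q) (w a : ℤ → ℝ≥0∞) :
    lqNorm q (fun k => ∑' n, w (k - n) * a n) ≤ (∑' j, w j) * lqNorm q a := by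
  have hleft : ∀ k, ∑' n, w (k - n) = ∑' j, w j := fun k => (Equiv.subLeft k).tsum_eq w
  have hright : ∀ n, ∑' k, w (k - n) = ∑' j, w j := fun n => (Equiv.subRight n).tsum_eq w
  rcases eq_or_ne q ∞ with rfl | ht
  · simp_rw [lqNorm_top]
    refine iSup_le fun k => ?_
    rw [← hleft k, ← ENNReal.tsum_mul_right]
    gcongr
    exact le_iSup a _
  have hs := one_lt_toReal hq ht
  simp_rw [lqNorm_of_ne_top ht]
  set s := q.toReal
  have hs0 : 0 < s := by linarith
  have hinv : 0 ≤ 1 - 1 / s := by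
    rw [sub_nonneg, div_le_one hs0]; exact hs.le
  set W := ∑' j, w j with hW
  have hterm : ∀ k, (∑' n, w (k - n) * a n) ^ s ≤
      W ^ (s - 1) * ∑' n, w (k - n) * a n ^ s := fun k => by
    have hhol : ∑' n, (w (k - n) * a n ^ s) ^ (1 / s) * w (k - n) ^ (1 - 1 / s) ≤
        (∑' n, w (k - n) * a n ^ s) ^ (1 / s) * (∑' n, w (k - n)) ^ (1 - 1 / s) := by
      simp_rw [← lintegral_count]
      exact ENNReal.lintegral_mul_norm_pow_le (Measurable.of_discrete).aemeasurable
        (Measurable.of_discrete).aemeasurable (by positivity) hinv (by ring)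
    have heq : ∀ n, (w (k - n) * a n ^ s) ^ (1 / s) * w (k - n) ^ (1 - 1 / s) =
        w (k - n) * a n := fun n => by
      rw [ENNReal.mul_rpow_of_nonneg _ _ (by positivity), ← ENNReal.rpow_mul,
        mul_one_div_cancel hs0.ne', ENNReal.rpow_one, mul_right_comm,
        ← ENNReal.rpow_add_of_nonneg _ _ (by positivity) hinv, add_sub_cancel, ENNReal.rpow_one]
    simp_rw [heq, hleft k] at hhol
    calc _ ≤ ((∑' n, w (k - n) * a n ^ s) ^ (1 / s) * W ^ (1 - 1 / s)) ^ s := by gcongr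
      _ = _ := by
        rw [ENNReal.mul_rpow_of_nonneg _ _ hs0.le, ← ENNReal.rpow_mul, ← ENNReal.rpow_mul,
          one_div_mul_cancel hs0.ne', ENNReal.rpow_one, mul_comm]
        congr 2
        field_simp
  calc _ ≤ (∑' k, W ^ (s - 1) * ∑' n, w (k - n) * a n ^ s) ^ (1 / s) := by
        gcongr with k
        exact hterm k
    _ = (W ^ s * ∑' n, a n ^ s) ^ (1 / s) := by
        rw [ENNReal.tsum_mul_left, ENNReal.tsum_comm]
        simp_rw [ENNReal.tsum_mul_right, hright, ENNReal.tsum_mul_left]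
        rw [← mul_assoc, show W ^ s = W ^ (s - 1) * W from ?_]
        nth_rw 3 [← ENNReal.rpow_one W]
        rw [← ENNReal.rpow_add_of_nonneg _ _ (by linarith) (by norm_num), sub_add_cancel]
    _ = _ := by
        rw [ENNReal.mul_rpow_of_nonneg _ _ (by positivity), ← ENNReal.rpow_mul,
          mul_one_div_cancel hs0.ne', ENNReal.rpow_one]

end SequenceNorms

section LocalBounds

variable {μ : Measure X} {c : ℝ≥0∞} {J : ℤ → Type*} {pt : ∀ n, J n → X} [∀ n, Countable (J n)]

theorem DoublingFamily.avgOp_le_of_dist_le (h : DoublingFamily μ c pt) {p : ℝ} (hp : 1 < p)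
    {Λ : ℝ} {j : ℕ} (hj : Λ + 7 ≤ 2 ^ j) (n : ℤ) {f : X → ℝ≥0∞} (hf : Measurable f) {x z : X}
    (hxz : dist x z ≤ Λ * (2:ℝ) ^ (-n)) :
    avgOp μ pt n f x ≤
      c ^ 5 * (c ^ j * (μ (ball z ((2:ℝ) ^ (-n))))⁻¹ * ∫⁻ y, f y ^ p ∂μ) ^ (1 / p) := by
  have hp0 : 0 < p := by linarith
  have hinv : 0 ≤ 1 - 1 / p := by
    rw [sub_nonneg, div_le_one hp0]; exact hp.le
  have hρ : (0:ℝ) < 2 ^ (-n) := by positivity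
  set m := μ (ball z ((2:ℝ) ^ (-n))) with hm
  have hm0 : m ≠ 0 := (h.pos _ _ hρ).ne'
  set I := ∫⁻ y, f y ^ p ∂μ with hI
  have hone : avgOp μ pt n (fun _ => 1) x ≤ c ^ 5 := by
    refine le_trans ?_ (h.tsum_indicator_cell_le n x)
    rw [avgOp_eq]
    refine ENNReal.tsum_le_tsum fun i => indicator_le_indicator ?_
    rw [setLIntegral_const, one_mul]
    exact ENNReal.inv_mul_le_one _
  have hpow : avgOp μ pt n (fun y => f y ^ p) x ≤ c ^ 5 * (c ^ j * m⁻¹ * I) := by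
    rw [avgOp_eq]
    calc _ ≤ ∑' i, (cell pt n i).indicator (fun _ => (1 : ℝ≥0∞)) x * (c ^ j * m⁻¹ * I) := by
          refine ENNReal.tsum_le_tsum fun i => ?_
          by_cases hx : x ∈ cell pt n i
          · rw [indicator_of_mem hx, indicator_of_mem hx, one_mul]
            have hx' : dist x (pt n i) < 6 * (2:ℝ) ^ (-n) := hx
            have hmle : m ≤ c ^ j * μ (cell pt n i) := by
              refine (measure_mono (ball_subset_ball' (y := pt n i)
                (ε₂ := 2 ^ j * (2:ℝ) ^ (-n)) ?_)).trans
                (h.doubling.measure_ball_le (pt n i) (r := 6 * (2:ℝ) ^ (-n)) j (by positivity) ?_)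
              · have := dist_triangle_left z (pt n i) x
                nlinarith
              · have : (0:ℝ) < 2 ^ j := by positivity
                nlinarith [mul_pos this hρ]
            have hminv : (μ (cell pt n i))⁻¹ ≤ c ^ j * m⁻¹ := by
              calc (μ (cell pt n i))⁻¹ = (μ (cell pt n i))⁻¹ * (m * m⁻¹) := by
                    rw [ENNReal.mul_inv_cancel hm0 (h.fin _ _), mul_one]
                _ ≤ (μ (cell pt n i))⁻¹ * (c ^ j * μ (cell pt n i) * m⁻¹) := by gcongr
                _ = c ^ j * m⁻¹ * ((μ (cell pt n i))⁻¹ * μ (cell pt n i)) := by ring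
                _ ≤ c ^ j * m⁻¹ * 1 := by gcongr; exact ENNReal.inv_mul_le_one _
                _ = _ := mul_one _
            gcongr
            exact setLIntegral_le_lintegral _ _
          · simp [hx]
      _ = (∑' i, (cell pt n i).indicator (fun _ => (1 : ℝ≥0∞)) x) * (c ^ j * m⁻¹ * I) :=
          ENNReal.tsum_mul_right
      _ ≤ _ := by gcongr; exact h.tsum_indicator_cell_le n x
  calc avgOp μ pt n f x = avgOp μ pt n (fun y => (f y ^ p) ^ (1 / p) * 1 ^ (1 - 1 / p)) x := by
        congr 1
        funext y
        rw [← ENNReal.rpow_mul, mul_one_div_cancel hp0.ne', ENNReal.rpow_one, ENNReal.one_rpow,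
          mul_one]
    _ ≤ avgOp μ pt n (fun y => f y ^ p) x ^ (1 / p) * avgOp μ pt n (fun _ => 1) x ^ (1 - 1 / p) :=
        avgOp_rpow_mul_rpow_le μ pt n (hf.pow_const p) measurable_const (by positivity) hinv
          (by ring) x
    _ ≤ (c ^ 5 * (c ^ j * m⁻¹ * I)) ^ (1 / p) * (c ^ 5) ^ (1 - 1 / p) := by gcongr
    _ = _ := by
        rw [ENNReal.mul_rpow_of_nonneg _ _ (by positivity), mul_right_comm,
          ← ENNReal.rpow_add_of_nonneg _ _ (by positivity) hinv, add_sub_cancel, ENNReal.rpow_one]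

theorem avgOp_eq_zero_of_isEmpty (n : ℤ) [IsEmpty (J n)] (f : X → ℝ≥0∞) (x : X) :
    avgOp μ pt n f x = 0 := by
  rw [avgOp_eq, tsum_empty]

theorem ofReal_two_rpow (a : ℝ) : ENNReal.ofReal ((2 : ℝ) ^ a) = 2 ^ a := by
  rw [← ENNReal.ofReal_rpow_of_pos (by norm_num)]; norm_num

/-- The weighted sum of averages at a point of a ball of radius comparable to `2⁻ᵐ`: fine
generations are controlled by the sequence norm, coarse ones by the `L^p` norm of `f`. -/
theorem DoublingFamily.exists_tsum_avgOp_le (h : DoublingFamily μ c pt) {p β σ δ Λ : ℝ}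
    {q cσ : ℝ≥0∞} (hp : 1 < p) (hq : 1 < q) (hδβ : δ ≤ β) (hδσ : δ ≤ σ / p - β)
    (hσ : 0 ≤ σ) (hcσ : cσ ≠ ∞) (hqrd : IsQRD μ σ cσ)
    (hvalid : ∀ n, Nonempty (J n) → validIdx X n) (hΛ : 0 < Λ) :
    ∃ C : ℝ≥0∞, C ≠ ∞ ∧ ∀ (x₀ : X) (r : ℝ) (m : ℤ), (2:ℝ) ^ (-m) ≤ r → r < (2:ℝ) ^ (1 - m) →
      ∀ f : ℤ → X → ℝ≥0∞, (∀ n, Measurable (f n)) → ∀ x ∈ ball x₀ (Λ * r),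
        ∑' n : ℤ, (2 : ℝ≥0∞) ^ (β * ((m : ℝ) - n)) * avgOp μ pt n (f n) x ≤
          (∑' j, expWeight δ j) * (lqNorm q (fun n => avgOp μ pt n (f n) x) +
            C * ((∫⁻ y, lqNorm q (fun n => f n y) ^ p ∂μ) *
              (μ (ball x₀ (Λ * r)))⁻¹) ^ (1 / p)) := by
  have hp0 : 0 < p := by linarith
  obtain ⟨j, hj⟩ := pow_unbounded_of_one_lt (Λ + 7) (one_lt_two (α := ℝ))
  refine ⟨c ^ 5 * (c ^ j * (c ^ j * cσ * 2 ^ σ)) ^ (1 / p), ?_, ?_⟩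
  · refine ENNReal.mul_ne_top (ENNReal.pow_ne_top h.ne_top)
      (ENNReal.rpow_ne_top_of_nonneg (by positivity) ?_)
    exact ENNReal.mul_ne_top (ENNReal.pow_ne_top h.ne_top) (ENNReal.mul_ne_top
      (ENNReal.mul_ne_top (ENNReal.pow_ne_top h.ne_top) hcσ)
      (ENNReal.rpow_ne_top_of_nonneg hσ (by norm_num)))
  intro x₀ r m hmr hrm f hf x hx
  have hr : 0 < r := lt_of_lt_of_le (by positivity) hmr
  set M := μ (ball x₀ (Λ * r)) with hM
  have hM0 : M ≠ 0 := (h.pos _ _ (by positivity)).ne'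
  set I := ∫⁻ y, lqNorm q (fun n => f n y) ^ p ∂μ with hI
  rw [← tsum_expWeight_sub δ m, ← ENNReal.tsum_mul_right]
  refine ENNReal.tsum_le_tsum fun n => ?_
  rcases le_or_gt m n with hmn | hmn
  · have hmn' : (m : ℝ) ≤ n := by exact_mod_cast hmn
    refine mul_le_mul' ?_ ((le_lqNorm hq (fun n => avgOp μ pt n (f n) x) n).trans le_self_add)
    refine ENNReal.rpow_le_rpow_of_exponent_le (by norm_num) ?_
    push_cast
    rw [abs_of_nonneg (by linarith)]
    nlinarith
  rcases isEmpty_or_nonempty (J n) with hJ | hJ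
  · rw [avgOp_eq_zero_of_isEmpty, mul_zero]; exact zero_le
  have hmn' : (n : ℝ) + 1 ≤ m := by exact_mod_cast hmn
  have hrn : r < (2:ℝ) ^ (-n) := hrm.trans_le (zpow_le_zpow_right₀ (by norm_num) (by omega))
  have hρ : (0:ℝ) < 2 ^ (-n) := by positivity
  set m₂ := μ (ball x₀ ((2:ℝ) ^ (-n))) with hm₂
  have hratio : ENNReal.ofReal ((r / (2:ℝ) ^ (-n)) ^ σ) ≤ 2 ^ σ * 2 ^ (-(σ * ((m : ℝ) - n))) := by
    have h1 : r / (2:ℝ) ^ (-n) ≤ (2:ℝ) ^ ((1 : ℝ) - m + n) := by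
      rw [div_le_iff₀ hρ, ← Real.rpow_intCast, ← Real.rpow_add (by norm_num)]
      refine hrm.le.trans (le_of_eq ?_)
      rw [← Real.rpow_intCast]
      push_cast
      ring_nf
    calc _ ≤ ENNReal.ofReal (((2:ℝ) ^ ((1 : ℝ) - m + n)) ^ σ) := by gcongr
      _ = _ := by
        rw [← Real.rpow_mul (by norm_num), ofReal_two_rpow,
          ← ENNReal.rpow_add _ _ (by norm_num) (by norm_num)]
        ring_nf
  have hMm : M ≤ c ^ j * (cσ * (2 ^ σ * 2 ^ (-(σ * ((m : ℝ) - n)))) * m₂) := by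
    calc M ≤ c ^ j * μ (ball x₀ r) := h.doubling.measure_ball_le x₀ j hr (by nlinarith)
      _ ≤ c ^ j * (cσ * ENNReal.ofReal ((r / (2:ℝ) ^ (-n)) ^ σ) * m₂) := by
          gcongr
          exact hqrd x₀ r _ hr hrn (hvalid n hJ)
      _ ≤ _ := by gcongr
  have hm₂inv : m₂⁻¹ ≤ c ^ j * cσ * 2 ^ σ * 2 ^ (-(σ * ((m : ℝ) - n))) * M⁻¹ := by
    calc m₂⁻¹ = m₂⁻¹ * (M * M⁻¹) := by
          rw [ENNReal.mul_inv_cancel hM0 (h.fin _ _), mul_one]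
      _ ≤ m₂⁻¹ * (c ^ j * (cσ * (2 ^ σ * 2 ^ (-(σ * ((m : ℝ) - n)))) * m₂) * M⁻¹) := by gcongr
      _ = c ^ j * cσ * 2 ^ σ * 2 ^ (-(σ * ((m : ℝ) - n))) * M⁻¹ * (m₂⁻¹ * m₂) := by ring
      _ ≤ c ^ j * cσ * 2 ^ σ * 2 ^ (-(σ * ((m : ℝ) - n))) * M⁻¹ * 1 := by
          gcongr; exact ENNReal.inv_mul_le_one _
      _ = _ := mul_one _
  have hfI : ∫⁻ y, f n y ^ p ∂μ ≤ I := by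
    refine lintegral_mono fun y => ENNReal.rpow_le_rpow ?_ hp0.le
    exact le_lqNorm hq (fun n => f n y) n
  have hdist : dist x x₀ ≤ Λ * (2:ℝ) ^ (-n) := by
    have : dist x x₀ < Λ * r := hx
    nlinarith
  have hweight : (2 : ℝ≥0∞) ^ (β * ((m : ℝ) - n)) *
      (2 ^ (-(σ * ((m : ℝ) - n)))) ^ (1 / p) ≤ expWeight δ (n - m) := by
    rw [← ENNReal.rpow_mul, ← ENNReal.rpow_add _ _ (by norm_num) (by norm_num)]
    refine ENNReal.rpow_le_rpow_of_exponent_le (by norm_num) ?_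
    push_cast
    rw [abs_of_nonpos (by linarith)]
    have : -(σ * ((m : ℝ) - n)) * (1 / p) = -(σ / p * (m - n)) := by ring
    rw [this]
    nlinarith
  calc _ ≤ (2 : ℝ≥0∞) ^ (β * ((m : ℝ) - n)) * (c ^ 5 * (c ^ j *
          (c ^ j * cσ * 2 ^ σ * 2 ^ (-(σ * ((m : ℝ) - n))) * M⁻¹) * I) ^ (1 / p)) := by
        gcongr
        refine (h.avgOp_le_of_dist_le hp hj.le n (hf n) hdist).trans ?_
        gcongr
    _ = ((2 : ℝ≥0∞) ^ (β * ((m : ℝ) - n)) * (2 ^ (-(σ * ((m : ℝ) - n)))) ^ (1 / p)) *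
          (c ^ 5 * (c ^ j * (c ^ j * cσ * 2 ^ σ)) ^ (1 / p) * (I * M⁻¹) ^ (1 / p)) := by
        rw [show c ^ j * (c ^ j * cσ * 2 ^ σ * 2 ^ (-(σ * ((m : ℝ) - n))) * M⁻¹) * I =
          2 ^ (-(σ * ((m : ℝ) - n))) * (c ^ j * (c ^ j * cσ * 2 ^ σ) * (I * M⁻¹)) by ring,
          ENNReal.mul_rpow_of_nonneg _ _ (by positivity : 0 ≤ 1 / p),
          ENNReal.mul_rpow_of_nonneg _ (I * M⁻¹) (by positivity : 0 ≤ 1 / p)]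
        ring
    _ ≤ _ := by
        gcongr
        exact le_add_self

end LocalBounds

section SmoothAverages

variable {μ : Measure X} {c : ℝ≥0∞} {J : ℤ → Type*} {pt : ∀ n, J n → X} [∀ n, Countable (J n)]
  {ψ : ∀ n, J n → X → ℝ} {L : ℝ}

/-- Weights between `0` and `1` that are supported in the cells of a family and are Lipschitz
at the matching scale. -/
structure IsBumpFamily (pt : ∀ n, J n → X) (ψ : ∀ n, J n → X → ℝ) (L : ℝ) : Prop where
  nonneg : ∀ n i x, 0 ≤ ψ n i x
  le_one : ∀ n i x, ψ n i x ≤ 1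
  eq_zero : ∀ n i, ∀ x ∉ cell pt n i, ψ n i x = 0
  lipschitz : ∀ n i x y, |ψ n i x - ψ n i y| ≤ L * (2:ℝ) ^ n * dist x y

/-- The superposition of the averages over the balls of generation `n`, weighted by `ψ`. -/
def smoothAvg (μ : Measure X) (pt : ∀ n, J n → X) (ψ : ∀ n, J n → X → ℝ) (n : ℤ)
    (f : X → ℝ≥0∞) (x : X) : ℝ≥0∞ :=
  ∑' i, ENNReal.ofReal (ψ n i x) *
    ((∫⁻ y in ball (pt n i) (3 * (2:ℝ) ^ (-n)), f y ∂μ) / μ (ball (pt n i) (3 * (2:ℝ) ^ (-n))))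

theorem DoublingFamily.average_le (h : DoublingFamily μ c pt) (n : ℤ) (i : J n)
    (f : X → ℝ≥0∞) :
    (∫⁻ y in ball (pt n i) (3 * (2:ℝ) ^ (-n)), f y ∂μ) / μ (ball (pt n i) (3 * (2:ℝ) ^ (-n))) ≤
      c * ((μ (cell pt n i))⁻¹ * ∫⁻ y in cell pt n i, f y ∂μ) := by
  have hρ : (0:ℝ) < 2 ^ (-n) := by positivity
  have hcell : cell pt n i = ball (pt n i) (2 * (3 * (2:ℝ) ^ (-n))) := by
    rw [cell]; congr 1; ring
  set m := μ (ball (pt n i) (3 * (2:ℝ) ^ (-n))) with hm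
  have hle : μ (cell pt n i) ≤ c * m := by
    rw [hcell]; exact h.doubling _ _ (by positivity)
  have hinv : m⁻¹ ≤ c * (μ (cell pt n i))⁻¹ := by
    calc m⁻¹ = m⁻¹ * (μ (cell pt n i) * (μ (cell pt n i))⁻¹) := by
          rw [ENNReal.mul_inv_cancel (h.measure_cell_pos n i) (h.measure_cell_ne_top n i), mul_one]
      _ ≤ m⁻¹ * (c * m * (μ (cell pt n i))⁻¹) := by gcongr
      _ = c * (μ (cell pt n i))⁻¹ * (m⁻¹ * m) := by ring
      _ ≤ c * (μ (cell pt n i))⁻¹ * 1 := by gcongr; exact ENNReal.inv_mul_le_one _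
      _ = _ := mul_one _
  rw [ENNReal.div_eq_inv_mul, ← mul_assoc]
  refine mul_le_mul' hinv (lintegral_mono_set ?_)
  rw [hcell]
  exact ball_subset_ball (by linarith)

theorem DoublingFamily.tsum_indicator_mul_average_le (h : DoublingFamily μ c pt) (n : ℤ)
    (f : X → ℝ≥0∞) (x : X) :
    ∑' i, (cell pt n i).indicator (fun _ => (1 : ℝ≥0∞)) x *
      ((∫⁻ y in ball (pt n i) (3 * (2:ℝ) ^ (-n)), f y ∂μ) /
        μ (ball (pt n i) (3 * (2:ℝ) ^ (-n)))) ≤ c * avgOp μ pt n f x := by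
  rw [avgOp_eq, ← ENNReal.tsum_mul_left]
  refine ENNReal.tsum_le_tsum fun i => ?_
  by_cases hx : x ∈ cell pt n i
  · rw [indicator_of_mem hx, indicator_of_mem hx, one_mul]
    exact h.average_le n i f
  · simp [hx]

theorem DoublingFamily.smoothAvg_le (h : DoublingFamily μ c pt) (hψ : IsBumpFamily pt ψ L)
    (n : ℤ) (f : X → ℝ≥0∞) (x : X) : smoothAvg μ pt ψ n f x ≤ c * avgOp μ pt n f x := by
  refine le_trans (ENNReal.tsum_le_tsum fun i => ?_) (h.tsum_indicator_mul_average_le n f x)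
  gcongr
  by_cases hx : x ∈ cell pt n i
  · rw [indicator_of_mem hx]
    exact ENNReal.ofReal_le_one.2 (hψ.le_one n i x)
  · simp [hψ.eq_zero n i x hx]

theorem IsBumpFamily.ofReal_le (hψ : IsBumpFamily pt ψ L) (n : ℤ) (i : J n) (x y : X) :
    ENNReal.ofReal (ψ n i x) ≤ ENNReal.ofReal (ψ n i y) +
      ENNReal.ofReal (min 1 (L * (2:ℝ) ^ n * dist x y)) *
        (cell pt n i).indicator (fun _ => (1 : ℝ≥0∞)) x := by
  by_cases hx : x ∈ cell pt n i
  · rw [indicator_of_mem hx, mul_one]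
    refine (ENNReal.ofReal_le_ofReal ?_).trans ENNReal.ofReal_add_le
    rw [← min_add_add_left]
    refine le_min ?_ ?_
    · linarith [hψ.le_one n i x, hψ.nonneg n i y]
    · linarith [le_abs_self (ψ n i x - ψ n i y), hψ.lipschitz n i x y]
  · simp [hψ.eq_zero n i x hx]

theorem DoublingFamily.smoothAvg_le_add (h : DoublingFamily μ c pt) (hψ : IsBumpFamily pt ψ L)
    (n : ℤ) (f : X → ℝ≥0∞) (x y : X) :
    smoothAvg μ pt ψ n f x ≤ smoothAvg μ pt ψ n f y +
      ENNReal.ofReal (min 1 (L * (2:ℝ) ^ n * dist x y)) * (c * avgOp μ pt n f x) := by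
  calc smoothAvg μ pt ψ n f x
      ≤ ∑' i, (ENNReal.ofReal (ψ n i y) +
        ENNReal.ofReal (min 1 (L * (2:ℝ) ^ n * dist x y)) *
          (cell pt n i).indicator (fun _ => (1 : ℝ≥0∞)) x) *
          ((∫⁻ y in ball (pt n i) (3 * (2:ℝ) ^ (-n)), f y ∂μ) /
            μ (ball (pt n i) (3 * (2:ℝ) ^ (-n)))) :=
        ENNReal.tsum_le_tsum fun i => mul_le_mul_left (hψ.ofReal_le n i x y) _
    _ ≤ _ := by
        simp_rw [add_mul, mul_assoc (ENNReal.ofReal (min _ _))]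
        rw [ENNReal.tsum_add, ENNReal.tsum_mul_left]
        exact add_le_add le_rfl (mul_le_mul_right (h.tsum_indicator_mul_average_le n f x) _)

theorem ofReal_abs_toReal_sub_le {a b D : ℝ≥0∞} (ha : a ≠ ∞) (hb : b ≠ ∞) (hab : a ≤ b + D)
    (hba : b ≤ a + D) : ENNReal.ofReal |a.toReal - b.toReal| ≤ D := by
  rcases eq_or_ne D ∞ with rfl | hD
  · exact le_top
  refine ENNReal.ofReal_le_of_le_toReal (abs_le.2 ⟨?_, ?_⟩)
  · have := ENNReal.toReal_mono (ENNReal.add_ne_top.2 ⟨ha, hD⟩) hba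
    rw [ENNReal.toReal_add ha hD] at this
    linarith
  · have := ENNReal.toReal_mono (ENNReal.add_ne_top.2 ⟨hb, hD⟩) hab
    rw [ENNReal.toReal_add hb hD] at this
    linarith

theorem DoublingFamily.exists_avgOp_le_of_mem_ball (h : DoublingFamily μ c pt) {p : ℝ}
    (hp : 1 < p) (n : ℤ) {f : X → ℝ≥0∞} (hf : Measurable f) (hfin : ∫⁻ y, f y ^ p ∂μ ≠ ∞)
    (z : X) : ∃ K : ℝ≥0∞, K ≠ ∞ ∧ ∀ x ∈ ball z ((2:ℝ) ^ (-n)), avgOp μ pt n f x ≤ K := by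
  refine ⟨_, ?_, fun x hx => h.avgOp_le_of_dist_le hp (Λ := 1) (j := 3) (by norm_num) n hf
    (z := z) ?_⟩
  · have hm := (h.pos z _ (by positivity : (0:ℝ) < 2 ^ (-n))).ne'
    refine ENNReal.mul_ne_top (ENNReal.pow_ne_top h.ne_top)
      (ENNReal.rpow_ne_top_of_nonneg (by positivity) ?_)
    exact ENNReal.mul_ne_top (ENNReal.mul_ne_top (ENNReal.pow_ne_top h.ne_top)
      (ENNReal.inv_ne_top.2 hm)) hfin
  · rw [one_mul]; exact (mem_ball.1 hx).le

theorem DoublingFamily.smoothAvg_ne_top (h : DoublingFamily μ c pt) (hψ : IsBumpFamily pt ψ L)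
    {p : ℝ} (hp : 1 < p) (n : ℤ) {f : X → ℝ≥0∞} (hf : Measurable f)
    (hfin : ∫⁻ y, f y ^ p ∂μ ≠ ∞) (x : X) : smoothAvg μ pt ψ n f x ≠ ∞ := by
  obtain ⟨K, hK, hle⟩ := h.exists_avgOp_le_of_mem_ball hp n hf hfin x
  exact ne_top_of_le_ne_top (ENNReal.mul_ne_top h.ne_top hK) ((h.smoothAvg_le hψ n f x).trans
    (mul_le_mul_right (hle x (mem_ball_self (by positivity))) _))

theorem DoublingFamily.continuous_smoothAvg (h : DoublingFamily μ c pt)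
    (hψ : IsBumpFamily pt ψ L) (hL : 0 ≤ L) {p : ℝ} (hp : 1 < p) (n : ℤ) {f : X → ℝ≥0∞}
    (hf : Measurable f) (hfin : ∫⁻ y, f y ^ p ∂μ ≠ ∞) : Continuous (smoothAvg μ pt ψ n f) := by
  have hne := h.smoothAvg_ne_top hψ hp n hf hfin
  suffices hv : Continuous fun x => (smoothAvg μ pt ψ n f x).toReal by
    have := ENNReal.continuous_ofReal.comp hv
    refine this.congr fun x => ENNReal.ofReal_toReal (hne x)
  refine continuous_iff_continuousAt.2 fun z => ?_
  obtain ⟨K, hK, hle⟩ := h.exists_avgOp_le_of_mem_ball hp n hf hfin z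
  have hρ : (0:ℝ) < 2 ^ (-n) := by positivity
  refine continuousAt_of_locally_lipschitz hρ (L * (2:ℝ) ^ n * (c * K).toReal) fun x hx => ?_
  have hcK : c * K ≠ ∞ := ENNReal.mul_ne_top h.ne_top hK
  have key : ∀ y ∈ ball z ((2:ℝ) ^ (-n)), ∀ w : X, dist y w = dist x z →
      smoothAvg μ pt ψ n f y ≤ smoothAvg μ pt ψ n f w +
        ENNReal.ofReal (L * (2:ℝ) ^ n * dist x z) * (c * K) := fun y hy w hd => by
    refine (h.smoothAvg_le_add hψ n f y w).trans ?_
    rw [hd]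
    gcongr
    · exact min_le_right _ _
    · exact hle y hy
  have := ofReal_abs_toReal_sub_le (hne x) (hne z) (key x hx z rfl)
    (key z (mem_ball_self hρ) x (dist_comm _ _))
  have h2 := ENNReal.toReal_mono (ENNReal.mul_ne_top ENNReal.ofReal_ne_top hcK) this
  rw [ENNReal.toReal_ofReal (abs_nonneg _), ENNReal.toReal_mul,
    ENNReal.toReal_ofReal (by positivity)] at h2
  rw [Real.dist_eq]
  linarith

end SmoothAverages

theorem two_rpow_mul_min_le {β δ L d : ℝ} (hδβ : δ ≤ β) (hδβ' : δ ≤ 1 - β) (hβ : 0 < β) (hβ1 : β ≤ 1)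
    (k n : ℤ) (hdk : (2:ℝ) ^ (-k - 1) ≤ d) (hd : d < (2:ℝ) ^ (-k)) :
    (2 : ℝ≥0∞) ^ (-β * (n : ℝ)) * ENNReal.ofReal (min 1 (L * (2:ℝ) ^ n * d)) ≤
      ENNReal.ofReal (d ^ β) * (ENNReal.ofReal (max L 1 * 2 ^ β) * expWeight δ (k - n)) := by
  have hd0 : 0 < d := lt_of_lt_of_le (by positivity) hdk
  rw [expWeight, ← ofReal_two_rpow, ← ofReal_two_rpow, ← ENNReal.ofReal_mul (by positivity),
    ← ENNReal.ofReal_mul (by positivity), ← ENNReal.ofReal_mul (by positivity)]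
  refine ENNReal.ofReal_le_ofReal ?_
  have h2β : (1:ℝ) ≤ 2 ^ β := Real.one_le_rpow (by norm_num) hβ.le
  rcases le_or_gt n k with hnk | hnk
  · have hnk' : (n : ℝ) ≤ k := by exact_mod_cast hnk
    have h1 : d ≤ d ^ β * (2:ℝ) ^ (-(1 - β) * k) := by
      calc d = d ^ β * d ^ (1 - β) := by
            rw [← Real.rpow_add hd0, add_sub_cancel, Real.rpow_one]
        _ ≤ d ^ β * ((2:ℝ) ^ (-k)) ^ (1 - β) := by gcongr
        _ = _ := by
            rw [← Real.rpow_intCast, ← Real.rpow_mul (by norm_num)]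
            congr 2
            push_cast
            ring
    calc (2:ℝ) ^ (-β * (n : ℝ)) * min 1 (L * (2:ℝ) ^ n * d)
        ≤ (2:ℝ) ^ (-β * (n : ℝ)) * (max L 1 * (2:ℝ) ^ n * d) := by
          gcongr
          refine (min_le_right _ _).trans ?_
          gcongr
          exact le_max_left _ _
      _ ≤ (2:ℝ) ^ (-β * (n : ℝ)) * (max L 1 * (2:ℝ) ^ n *
            (d ^ β * (2:ℝ) ^ (-(1 - β) * k))) := by gcongr
      _ = d ^ β * (max L 1 * 1 * (2:ℝ) ^ (-((1 - β) * (k - n)))) := by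
          rw [show -((1 - β) * ((k : ℝ) - n)) = -β * n + n + -(1 - β) * k by ring,
            Real.rpow_add (by norm_num), Real.rpow_add (by norm_num), Real.rpow_intCast]
          ring
      _ ≤ _ := by
          have hw : (2:ℝ) ^ (-((1 - β) * ((k:ℝ) - n))) ≤ 2 ^ (-(δ * |((k - n : ℤ) : ℝ)|)) := by
            refine Real.rpow_le_rpow_of_exponent_le (by norm_num) ?_
            push_cast
            rw [abs_of_nonneg (by linarith)]
            nlinarith
          gcongr
  · have hnk' : (k : ℝ) + 1 ≤ n := by exact_mod_cast hnk
    have h1 : (2:ℝ) ^ (-β * k) ≤ 2 ^ β * d ^ β := by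
      calc (2:ℝ) ^ (-β * k) = 2 ^ β * ((2:ℝ) ^ (-k - 1)) ^ β := by
            rw [← Real.rpow_intCast, ← Real.rpow_mul (by norm_num), ← Real.rpow_add (by norm_num)]
            congr 1
            push_cast
            ring
        _ ≤ _ := by gcongr
    calc (2:ℝ) ^ (-β * (n : ℝ)) * min 1 (L * (2:ℝ) ^ n * d)
        ≤ (2:ℝ) ^ (-β * (n : ℝ)) * 1 := by
          gcongr
          exact min_le_left _ _
      _ = (2:ℝ) ^ (-β * k) * (2:ℝ) ^ (-(β * (n - k))) := by
          rw [← Real.rpow_add (by norm_num), mul_one]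
          congr 1
          ring
      _ ≤ 2 ^ β * d ^ β * (2:ℝ) ^ (-(δ * |((k - n : ℤ) : ℝ)|)) := by
          gcongr
          · norm_num
          · push_cast
            rw [abs_of_nonpos (by linarith)]
            nlinarith
      _ = d ^ β * (1 * 2 ^ β * (2:ℝ) ^ (-(δ * |((k - n : ℤ) : ℝ)|))) := by ring
      _ ≤ _ := by
          gcongr
          exact le_max_right _ _

section Capacity

variable {μ : Measure X} {c : ℝ≥0∞} {J : ℤ → Type*} {pt : ∀ n, J n → X} [∀ n, Countable (J n)]
  {ψ : ∀ n, J n → X → ℝ} {L : ℝ}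

/-- A partial sum of the discrete potential. -/
def partialPot (μ : Measure X) (β : ℝ) (pt : ∀ n, J n → X) (ψ : ∀ n, J n → X → ℝ)
    (f : ℤ → X → ℝ≥0∞) (S : Finset ℤ) (x : X) : ℝ≥0∞ :=
  ∑ n ∈ S, (2 : ℝ≥0∞) ^ (-β * (n : ℝ)) * smoothAvg μ pt ψ n (f n) x

/-- A cutoff function equal to `1` on the closed ball of radius `r` and to `0` outside the
ball of radius `2 * r`. -/
def ballCutoff (x₀ : X) (r : ℝ) (x : X) : ℝ := max 0 (min 1 (2 - dist x x₀ / r))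

theorem ballCutoff_nonneg (x₀ : X) (r : ℝ) (x : X) : 0 ≤ ballCutoff x₀ r x := le_max_left _ _

theorem ballCutoff_le_one (x₀ : X) (r : ℝ) (x : X) : ballCutoff x₀ r x ≤ 1 :=
  max_le zero_le_one (min_le_left _ _)

theorem continuous_ballCutoff (x₀ : X) (r : ℝ) : Continuous (ballCutoff x₀ r) := by
  unfold ballCutoff
  fun_prop

theorem ballCutoff_eq_one {x₀ x : X} {r : ℝ} (hr : 0 < r) (hx : dist x x₀ ≤ r) :
    ballCutoff x₀ r x = 1 := by
  have : dist x x₀ / r ≤ 1 := (div_le_one hr).2 hx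
  rw [ballCutoff, min_eq_left (by linarith), max_eq_right zero_le_one]

theorem ballCutoff_eq_zero {x₀ x : X} {r : ℝ} (hr : 0 < r) (hx : x ∉ ball x₀ (2 * r)) :
    ballCutoff x₀ r x = 0 := by
  have : 2 ≤ dist x x₀ / r := (le_div_iff₀ hr).2 (not_lt.1 hx)
  exact max_eq_left ((min_le_right _ _).trans (by linarith))

theorem abs_ballCutoff_sub_le (x₀ : X) {r : ℝ} {m : ℤ} (hm : (2:ℝ) ^ (-m) ≤ r) (x y : X) :
    |ballCutoff x₀ r x - ballCutoff x₀ r y| ≤ min 1 (1 * (2:ℝ) ^ m * dist x y) := by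
  have h2 : (0:ℝ) < 2 ^ (-m) := by positivity
  have hr : 0 < r := h2.trans_le hm
  refine le_min ?_ ?_
  · exact abs_sub_le_of_nonneg_of_le (ballCutoff_nonneg _ _ _) (ballCutoff_le_one _ _ _)
      (ballCutoff_nonneg _ _ _) (ballCutoff_le_one _ _ _)
  · calc |ballCutoff x₀ r x - ballCutoff x₀ r y|
        ≤ |min 1 (2 - dist x x₀ / r) - min 1 (2 - dist y x₀ / r)| := by
          rw [ballCutoff, ballCutoff, max_comm 0, max_comm 0]
          exact abs_max_sub_max_le_abs _ _ _
      _ ≤ |(2 - dist x x₀ / r) - (2 - dist y x₀ / r)| := by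
          refine (abs_min_sub_min_le_max _ _ _ _).trans ?_
          simp
      _ = |dist x x₀ - dist y x₀| / r := by
          rw [← abs_of_pos hr, ← abs_div, abs_of_pos hr, ← abs_neg]
          congr 1
          ring
      _ ≤ dist x y / r := by gcongr; exact abs_dist_sub_le _ _ _
      _ ≤ dist x y / (2:ℝ) ^ (-m) := by gcongr
      _ = _ := by rw [zpow_neg, div_inv_eq_mul]; ring

/-- The candidate gradient of a truncated potential. -/
def potGrad (μ : Measure X) (β δ : ℝ) (C : ℝ≥0∞) (m : ℤ) (pt : ∀ n, J n → X)
    (f : ℤ → X → ℝ≥0∞) (k : ℤ) (x : X) : ℝ≥0∞ :=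
  C * (∑' n, expWeight δ (k - n) * avgOp μ pt n (f n) x +
    expWeight δ (k - m) * ∑' n : ℤ, (2 : ℝ≥0∞) ^ (β * ((m : ℝ) - n)) * avgOp μ pt n (f n) x)

theorem measurable_potGrad (β δ : ℝ) (C : ℝ≥0∞) (m : ℤ) (f : ℤ → X → ℝ≥0∞) (k : ℤ) :
    Measurable (potGrad μ β δ C m pt f k) := by
  refine Measurable.const_mul (Measurable.add ?_ (Measurable.const_mul ?_ _)) _
  · exact Measurable.tsum fun n => (measurable_avgOp μ pt n _).const_mul _
  · exact Measurable.tsum fun n => (measurable_avgOp μ pt n _).const_mul _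

theorem DoublingFamily.partialPot_le (h : DoublingFamily μ c pt) (hψ : IsBumpFamily pt ψ L)
    (β : ℝ) (f : ℤ → X → ℝ≥0∞) (S : Finset ℤ) (m : ℤ) (x : X) :
    partialPot μ β pt ψ f S x ≤ c * ((2 : ℝ≥0∞) ^ (-β * (m : ℝ)) *
      ∑' n : ℤ, (2 : ℝ≥0∞) ^ (β * ((m : ℝ) - n)) * avgOp μ pt n (f n) x) := by
  rw [← ENNReal.tsum_mul_left, ← ENNReal.tsum_mul_left]
  refine le_trans (Finset.sum_le_sum fun n _ => ?_) (ENNReal.sum_le_tsum S)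
  rw [← mul_assoc ((2 : ℝ≥0∞) ^ (-β * (m : ℝ))),
    ← ENNReal.rpow_add _ _ (by norm_num) (by norm_num),
    show -β * (m : ℝ) + β * ((m : ℝ) - n) = -β * n by ring, mul_left_comm]
  gcongr
  exact h.smoothAvg_le hψ n (f n) x

theorem DoublingFamily.partialPot_le_add (h : DoublingFamily μ c pt) (hψ : IsBumpFamily pt ψ L)
    {β δ : ℝ} (hδβ : δ ≤ β) (hδβ' : δ ≤ 1 - β) (hβ : 0 < β) (hβ1 : β ≤ 1) (f : ℤ → X → ℝ≥0∞)
    (S : Finset ℤ) {k : ℤ} {x y : X} (hk : (2:ℝ) ^ (-k - 1) ≤ dist x y)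
    (hk' : dist x y < (2:ℝ) ^ (-k)) :
    partialPot μ β pt ψ f S x ≤ partialPot μ β pt ψ f S y + ENNReal.ofReal (dist x y ^ β) *
      (ENNReal.ofReal (max L 1 * 2 ^ β) * c *
        ∑' n, expWeight δ (k - n) * avgOp μ pt n (f n) x) := by
  calc partialPot μ β pt ψ f S x
      ≤ ∑ n ∈ S, ((2 : ℝ≥0∞) ^ (-β * (n : ℝ)) * smoothAvg μ pt ψ n (f n) y +
          ENNReal.ofReal (dist x y ^ β) * (ENNReal.ofReal (max L 1 * 2 ^ β) * c *
            (expWeight δ (k - n) * avgOp μ pt n (f n) x))) := by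
        refine Finset.sum_le_sum fun n _ => ?_
        calc _ ≤ (2 : ℝ≥0∞) ^ (-β * (n : ℝ)) * (smoothAvg μ pt ψ n (f n) y +
              ENNReal.ofReal (min 1 (L * (2:ℝ) ^ n * dist x y)) *
                (c * avgOp μ pt n (f n) x)) := by
              gcongr
              exact h.smoothAvg_le_add hψ n (f n) x y
          _ = (2 : ℝ≥0∞) ^ (-β * (n : ℝ)) * smoothAvg μ pt ψ n (f n) y +
              ((2 : ℝ≥0∞) ^ (-β * (n : ℝ)) *
                ENNReal.ofReal (min 1 (L * (2:ℝ) ^ n * dist x y))) *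
                (c * avgOp μ pt n (f n) x) := by ring
          _ ≤ (2 : ℝ≥0∞) ^ (-β * (n : ℝ)) * smoothAvg μ pt ψ n (f n) y +
              (ENNReal.ofReal (dist x y ^ β) *
                (ENNReal.ofReal (max L 1 * 2 ^ β) * expWeight δ (k - n))) *
                (c * avgOp μ pt n (f n) x) :=
              add_le_add le_rfl
                (mul_le_mul_left (two_rpow_mul_min_le hδβ hδβ' hβ hβ1 k n hk hk') _)
          _ = _ := by ring
    _ ≤ _ := by
        rw [Finset.sum_add_distrib, ← Finset.mul_sum, ← Finset.mul_sum]
        refine add_le_add le_rfl (mul_le_mul_right (mul_le_mul_right ?_ _) _)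
        exact ENNReal.sum_le_tsum S

theorem DoublingFamily.isFracGrad_potGrad (h : DoublingFamily μ c pt) (hψ : IsBumpFamily pt ψ L)
    {β δ : ℝ} (hδβ : δ ≤ β) (hδβ' : δ ≤ 1 - β) (hβ : 0 < β) (hβ1 : β ≤ 1) (f : ℤ → X → ℝ≥0∞)
    (S : Finset ℤ) (hfin : ∀ x, partialPot μ β pt ψ f S x ≠ ∞) (x₀ : X) {r : ℝ} {m : ℤ}
    (hm : (2:ℝ) ^ (-m) ≤ r) (Ω : Set X) :
    IsFracGrad μ β Ω (fun x => 2 * (partialPot μ β pt ψ f S x).toReal * ballCutoff x₀ r x)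
      (potGrad μ β δ (2 * (ENNReal.ofReal (max L 1 * 2 ^ β) * c)) m pt f) := by
  refine ⟨measurable_potGrad β δ _ m f, ∅, empty_subset _, measure_empty, ?_⟩
  intro k x _ y _ hk hk'
  set U := partialPot μ β pt ψ f S with hU
  set η := ballCutoff x₀ r with hη
  set A := ENNReal.ofReal (max L 1 * 2 ^ β) with hA
  set dβ := ENNReal.ofReal (dist x y ^ β) with hdβ
  set T : X → ℝ≥0∞ := fun z => ∑' n, expWeight δ (k - n) * avgOp μ pt n (f n) z with hT
  set Y : X → ℝ≥0∞ := fun z =>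
    ∑' n : ℤ, (2 : ℝ≥0∞) ^ (β * ((m : ℝ) - n)) * avgOp μ pt n (f n) z with hY
  have hsub : ENNReal.ofReal |(U x).toReal - (U y).toReal| ≤ dβ * (A * c * (T x + T y)) := by
    refine ofReal_abs_toReal_sub_le (hfin x) (hfin y) ?_ ?_
    · refine (h.partialPot_le_add hψ hδβ hδβ' hβ hβ1 f S hk hk').trans ?_
      gcongr
      exact le_self_add
    · refine (h.partialPot_le_add hψ hδβ hδβ' hβ hβ1 f S (x := y) (y := x)
        (dist_comm x y ▸ hk) (dist_comm x y ▸ hk')).trans ?_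
      rw [dist_comm y x]
      gcongr
      exact le_add_self
  have hcut : U x * ENNReal.ofReal |η x - η y| ≤ dβ * (A * c * (expWeight δ (k - m) * Y x)) := by
    calc _ ≤ (c * ((2 : ℝ≥0∞) ^ (-β * (m : ℝ)) * Y x)) *
          ENNReal.ofReal (min 1 (1 * (2:ℝ) ^ m * dist x y)) := by
          gcongr
          · exact h.partialPot_le hψ β f S m x
          · exact abs_ballCutoff_sub_le x₀ hm x y
      _ = c * Y x * ((2 : ℝ≥0∞) ^ (-β * (m : ℝ)) *
          ENNReal.ofReal (min 1 (1 * (2:ℝ) ^ m * dist x y))) := by ring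
      _ ≤ c * Y x * (dβ * (ENNReal.ofReal (max (1:ℝ) 1 * 2 ^ β) * expWeight δ (k - m))) :=
          mul_le_mul_right (two_rpow_mul_min_le hδβ hδβ' hβ hβ1 k m hk hk') _
      _ ≤ c * Y x * (dβ * (A * expWeight δ (k - m))) := by
          gcongr
          rw [max_self, hA]
          gcongr
          exact le_max_right L 1
      _ = _ := by ring
  have habs : |2 * (U x).toReal * η x - 2 * (U y).toReal * η y| ≤
      2 * (|(U x).toReal - (U y).toReal| + (U x).toReal * |η x - η y|) := by
    have h1 : 2 * (U x).toReal * η x - 2 * (U y).toReal * η y =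
        2 * (((U x).toReal - (U y).toReal) * η y + (U x).toReal * (η x - η y)) := by ring
    rw [h1, abs_mul, abs_two]
    gcongr
    refine (abs_add_le _ _).trans ?_
    rw [abs_mul, abs_mul, abs_of_nonneg (ballCutoff_nonneg x₀ r y),
      abs_of_nonneg (ENNReal.toReal_nonneg (a := U x))]
    gcongr
    exact mul_le_of_le_one_right (abs_nonneg _) (ballCutoff_le_one x₀ r y)
  calc ENNReal.ofReal |2 * (U x).toReal * η x - 2 * (U y).toReal * η y|
      ≤ ENNReal.ofReal (2 * (|(U x).toReal - (U y).toReal| + (U x).toReal * |η x - η y|)) :=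
        ENNReal.ofReal_le_ofReal habs
    _ = 2 * (ENNReal.ofReal |(U x).toReal - (U y).toReal| +
          U x * ENNReal.ofReal |η x - η y|) := by
        rw [ENNReal.ofReal_mul (by norm_num), ENNReal.ofReal_add (by positivity) (by positivity),
          ENNReal.ofReal_mul ENNReal.toReal_nonneg, ENNReal.ofReal_toReal (hfin x)]
        norm_num
    _ ≤ 2 * (dβ * (A * c * (T x + T y)) + dβ * (A * c * (expWeight δ (k - m) * Y x))) := by
        gcongr
    _ ≤ 2 * (dβ * (A * c * (T x + T y)) + dβ * (A * c * (expWeight δ (k - m) * Y x))) +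
          2 * (dβ * (A * c * (expWeight δ (k - m) * Y y))) := le_self_add
    _ = _ := by
        simp only [potGrad]
        ring

theorem lqNorm_potGrad_le {q : ℝ≥0∞} (hq : 1 < q) (β δ : ℝ) (C : ℝ≥0∞) (m : ℤ)
    (f : ℤ → X → ℝ≥0∞) (x : X) :
    lqNorm q (fun k => potGrad μ β δ C m pt f k x) ≤
      C * ((∑' j, expWeight δ j) * (lqNorm q (fun n => avgOp μ pt n (f n) x) +
        ∑' n : ℤ, (2 : ℝ≥0∞) ^ (β * ((m : ℝ) - n)) * avgOp μ pt n (f n) x)) := by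
  refine (lqNorm_const_mul_le hq C _).trans (mul_le_mul_right ?_ C)
  refine (lqNorm_add_le hq _ _).trans ?_
  rw [mul_add]
  refine add_le_add (lqNorm_conv_le hq _ _) ((lqNorm_le_tsum hq _).trans ?_)
  rw [ENNReal.tsum_mul_right, tsum_expWeight_sub]

theorem DoublingFamily.exists_mixedNorm_potGrad_le (h : DoublingFamily μ c pt)
    {p β σ δ Λ : ℝ} {q cσ : ℝ≥0∞} (hp : 1 < p) (hq : 1 < q) (hδ : 0 < δ) (hδβ : δ ≤ β)
    (hδσ : δ ≤ σ / p - β) (hσ : 0 ≤ σ) (hcσ : cσ ≠ ∞) (hqrd : IsQRD μ σ cσ)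
    (hvalid : ∀ n, Nonempty (J n) → validIdx X n) (hΛ : 0 < Λ) {C₀ : ℝ≥0∞} (hC₀ : C₀ ≠ ∞) :
    ∃ C : ℝ≥0∞, C ≠ ∞ ∧ ∀ (x₀ : X) (r : ℝ) (m : ℤ), (2:ℝ) ^ (-m) ≤ r → r < (2:ℝ) ^ (1 - m) →
      ∀ f : ℤ → X → ℝ≥0∞, (∀ n, Measurable (f n)) →
        mixedNorm μ (ball x₀ (Λ * r)) p q (potGrad μ β δ C₀ m pt f) ^ p ≤
          C * ∫⁻ y, lqNorm q (fun n => f n y) ^ p ∂μ := by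
  have hp0 : 0 < p := by linarith
  obtain ⟨C₁, hC₁, hY⟩ := h.exists_tsum_avgOp_le hp hq hδβ hδσ hσ hcσ hqrd hvalid hΛ
  obtain ⟨C₂, hC₂, hT⟩ := h.exists_lintegral_lqNorm_avgOp_rpow_le hp hq
  have hW := tsum_expWeight_ne_top hδ
  set W := ∑' j, expWeight δ j with hWdef
  set C₃ := C₀ * ((W + W * W) * (1 + C₁)) with hC₃
  have hC₃' : C₃ ≠ ∞ := ENNReal.mul_ne_top hC₀ (ENNReal.mul_ne_top
    (ENNReal.add_ne_top.2 ⟨hW, ENNReal.mul_ne_top hW hW⟩)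
    (ENNReal.add_ne_top.2 ⟨ENNReal.one_ne_top, hC₁⟩))
  refine ⟨C₃ ^ p * (2 ^ (p - 1) * (C₂ + 1)), ?_, ?_⟩
  · refine ENNReal.mul_ne_top (ENNReal.rpow_ne_top_of_nonneg hp0.le hC₃') (ENNReal.mul_ne_top
      (ENNReal.rpow_ne_top_of_nonneg (by linarith) (by norm_num))
      (ENNReal.add_ne_top.2 ⟨hC₂, ENNReal.one_ne_top⟩))
  intro x₀ r m hmr hrm f hf
  have hr : 0 < r := lt_of_lt_of_le (by positivity) hmr
  set I := ∫⁻ y, lqNorm q (fun n => f n y) ^ p ∂μ with hI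
  set M := μ (ball x₀ (Λ * r)) with hM
  have hM0 : M ≠ 0 := (h.pos _ _ (by positivity)).ne'
  set t : X → ℝ≥0∞ := fun x => lqNorm q (fun n => avgOp μ pt n (f n) x) with ht
  have htm : Measurable t := measurable_lqNorm q fun n => measurable_avgOp μ pt n (f n)
  set Z := (I * M⁻¹) ^ (1 / p) with hZ
  have hpt : ∀ x ∈ ball x₀ (Λ * r),
      lqNorm q (fun k => potGrad μ β δ C₀ m pt f k x) ≤ C₃ * (t x + Z) := fun x hx => by
    refine (lqNorm_potGrad_le hq β δ C₀ m f x).trans ?_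
    rw [hC₃, mul_assoc]
    refine mul_le_mul_right ?_ C₀
    calc W * (t x + ∑' n : ℤ, (2 : ℝ≥0∞) ^ (β * ((m : ℝ) - n)) * avgOp μ pt n (f n) x)
        ≤ W * (t x + W * (t x + C₁ * Z)) := by
          gcongr
          exact hY x₀ r m hmr hrm f hf x hx
      _ ≤ W * (t x + W * (t x + C₁ * Z)) +
          (W * Z + W * W * Z + (W + W * W) * C₁ * t x + W * C₁ * Z) := le_self_add
      _ = _ := by ring
  have hpt' : ∀ x ∈ ball x₀ (Λ * r), lqNorm q (fun k => potGrad μ β δ C₀ m pt f k x) ^ p ≤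
      C₃ ^ p * (2 ^ (p - 1) * (t x ^ p + I * M⁻¹)) := fun x hx => by
    calc _ ≤ (C₃ * (t x + Z)) ^ p := by gcongr; exact hpt x hx
      _ = C₃ ^ p * (t x + Z) ^ p := ENNReal.mul_rpow_of_nonneg _ _ hp0.le
      _ ≤ C₃ ^ p * (2 ^ (p - 1) * (t x ^ p + Z ^ p)) := by
          gcongr
          exact ENNReal.rpow_add_le_mul_rpow_add_rpow _ _ hp.le
      _ = _ := by
          rw [hZ, ← ENNReal.rpow_mul, one_div_mul_cancel hp0.ne', ENNReal.rpow_one]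
  rw [mixedNorm, ← ENNReal.rpow_mul, one_div_mul_cancel hp0.ne', ENNReal.rpow_one]
  calc _ ≤ ∫⁻ x in ball x₀ (Λ * r), C₃ ^ p * (2 ^ (p - 1) * (t x ^ p + I * M⁻¹)) ∂μ :=
        setLIntegral_mono' measurableSet_ball hpt'
    _ = C₃ ^ p * (2 ^ (p - 1) * (∫⁻ x in ball x₀ (Λ * r), t x ^ p ∂μ + I * M⁻¹ * M)) := by
        rw [lintegral_const_mul _ (((htm.pow_const p).add_const _).const_mul _),
          lintegral_const_mul _ ((htm.pow_const p).add_const _),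
          lintegral_add_right _ measurable_const, setLIntegral_const]
    _ ≤ C₃ ^ p * (2 ^ (p - 1) * (C₂ * I + I)) := by
        gcongr
        · exact (setLIntegral_le_lintegral _ _).trans (hT f hf)
        · rw [mul_assoc]
          exact mul_le_of_le_one_right' (ENNReal.inv_mul_le_one _)
    _ = _ := by ring

theorem DoublingFamily.exists_relCap_le (h : DoublingFamily μ c pt) (hψ : IsBumpFamily pt ψ L)
    (hL : 0 ≤ L) {p β σ Λ : ℝ} {q cσ : ℝ≥0∞} (hp : 1 < p) (hq : 1 < q) (hβ0 : 0 < β)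
    (hβ1 : β < 1) (hσ : β * p < σ) (hcσ : cσ ≠ ∞) (hqrd : IsQRD μ σ cσ)
    (hvalid : ∀ n, Nonempty (J n) → validIdx X n) (hΛ : 0 < Λ) :
    ∃ C : ℝ≥0∞, C ≠ ∞ ∧ ∀ (x₀ : X) (r : ℝ), 0 < r →
      ∀ E : Set X, IsCompact E → E ⊆ closure (ball x₀ r) →
        ∀ f : ℤ → X → ℝ≥0∞, (∀ n, Measurable (f n)) →
          ∫⁻ y, lqNorm q (fun n => f n y) ^ p ∂μ ≠ ∞ →
          (∀ x ∈ E, 1 ≤ ∑' n : ℤ, (2 : ℝ≥0∞) ^ (-β * (n : ℝ)) * smoothAvg μ pt ψ n (f n) x) →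
          relCap μ β p q E x₀ r Λ ≤ C * ∫⁻ y, lqNorm q (fun n => f n y) ^ p ∂μ := by
  have hp0 : 0 < p := by linarith
  have hσp : 0 < σ / p - β := by
    rw [sub_pos, lt_div_iff₀ hp0]; exact hσ
  set δ := min β (min (1 - β) (σ / p - β)) with hδ
  have hδ0 : 0 < δ := lt_min hβ0 (lt_min (by linarith) hσp)
  have hδβ : δ ≤ β := min_le_left _ _
  have hδβ' : δ ≤ 1 - β := (min_le_right _ _).trans (min_le_left _ _)
  have hδσ : δ ≤ σ / p - β := (min_le_right _ _).trans (min_le_right _ _)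
  obtain ⟨C, hC, hle⟩ := h.exists_mixedNorm_potGrad_le hp hq hδ0 hδβ hδσ
    ((mul_pos hβ0 hp0).trans hσ).le hcσ hqrd hvalid hΛ
    (C₀ := 2 * (ENNReal.ofReal (max L 1 * 2 ^ β) * c))
    (ENNReal.mul_ne_top (by norm_num) (ENNReal.mul_ne_top ENNReal.ofReal_ne_top h.ne_top))
  refine ⟨C, hC, fun x₀ r hr E hE hEB f hf hfin hpot => ?_⟩
  have hfn : ∀ n, ∫⁻ y, f n y ^ p ∂μ ≠ ∞ := fun n => ne_top_of_le_ne_top hfin <|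
    lintegral_mono fun y => ENNReal.rpow_le_rpow (le_lqNorm hq (fun n => f n y) n) hp0.le
  have hweight : ∀ n : ℤ, (2 : ℝ≥0∞) ^ (-β * (n : ℝ)) ≠ ∞ := fun n =>
    ENNReal.rpow_ne_top_of_ne_zero (by norm_num) (by norm_num)
  have hcont : ∀ S, Continuous (partialPot μ β pt ψ f S) := fun S =>
    continuous_finsetSum S fun n _ =>
      (ENNReal.continuous_const_mul (hweight n)).comp
        (h.continuous_smoothAvg hψ hL hp n (hf n) (hfn n))
  have hne : ∀ S x, partialPot μ β pt ψ f S x ≠ ∞ := fun S x =>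
    ENNReal.sum_ne_top.2 fun n _ =>
      ENNReal.mul_ne_top (hweight n) (h.smoothAvg_ne_top hψ hp n (hf n) (hfn n) x)
  obtain ⟨S, hS⟩ := hE.elim_directed_cover (fun S => {x | 2⁻¹ < partialPot μ β pt ψ f S x})
    (fun S => isOpen_lt continuous_const (hcont S))
    (fun x hx => by
      have hlt : (2⁻¹ : ℝ≥0∞) < ∑' n : ℤ, (2 : ℝ≥0∞) ^ (-β * (n : ℝ)) *
          smoothAvg μ pt ψ n (f n) x :=
        (ENNReal.inv_lt_one.2 (by norm_num)).trans_le (hpot x hx)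
      rw [ENNReal.tsum_eq_iSup_sum, lt_iSup_iff] at hlt
      exact mem_iUnion.2 hlt)
    (directed_of_isDirected_le fun S T hST x hx => show 2⁻¹ < partialPot μ β pt ψ f T x from
      lt_of_lt_of_le (show 2⁻¹ < partialPot μ β pt ψ f S x from hx) (Finset.sum_le_sum_of_subset hST))
  obtain ⟨k, hk1, hk2⟩ := exists_mem_Ico_zpow hr (one_lt_two (α := ℝ))
  have hm1 : (2:ℝ) ^ (-(-k)) ≤ r := by rwa [neg_neg]
  have hm2 : r < (2:ℝ) ^ (1 - -k) := by rwa [sub_neg_eq_add, add_comm]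
  refine le_trans ?_ (hle x₀ r (-k) hm1 hm2 f hf)
  refine (iInf_le _ ⟨fun x => 2 * (partialPot μ β pt ψ f S x).toReal * ballCutoff x₀ r x,
    ?_, ?_, ?_⟩).trans ?_
  rotate_left
  · have : Continuous fun x => (partialPot μ β pt ψ f S x).toReal :=
      continuous_iff_continuousAt.2 fun x =>
        (ENNReal.tendsto_toReal (hne S x)).comp (hcont S).continuousAt
    exact (continuous_const.mul this).mul (continuous_ballCutoff x₀ r)
  · intro x hx
    beta_reduce
    rw [ballCutoff_eq_one hr (closure_ball_subset_closedBall (hEB hx)), mul_one]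
    have h1 := (ENNReal.toReal_le_toReal (by simp) (hne S x)).2 (le_of_lt (hS hx))
    rw [ENNReal.toReal_inv, ENNReal.toReal_ofNat] at h1
    linarith
  · intro x hx
    beta_reduce
    rw [ballCutoff_eq_zero hr hx, mul_zero]
  · refine ENNReal.rpow_le_rpow ?_ hp0.le
    exact iInf_le (fun g : {g : ℤ → X → ℝ≥0∞ // IsFracGrad μ β (ball x₀ (Λ * r)) _ g} =>
      mixedNorm μ (ball x₀ (Λ * r)) p q g.1)
      ⟨_, h.isFracGrad_potGrad hψ hδβ hδβ' hβ0 hβ1.le f S (hne S) x₀ hm1 _⟩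

end Capacity

theorem discPot_eq_tsum_smoothAvg {ι : ℤ → Type*} (μ : Measure X) (β : ℝ) (pt : ∀ n, ι n → X)
    (ψ : ∀ n, ι n → X → ℝ) (f : ℤ → X → ℝ≥0∞) (x : X) :
    discPot μ β pt ψ f x = ∑' n : ℤ, (2 : ℝ≥0∞) ^ (-β * (n : ℝ)) *
      smoothAvg μ (fun n (i : {_i : ι n // validIdx X n}) => pt n i.1)
        (fun n i => ψ n i.1) n (f n) x := by
  refine tsum_congr fun n => ?_
  split_ifs with hn
  · rw [smoothAvg]
    congr 1
    exact ((Equiv.subtypeUnivEquiv fun _ => hn).tsum_eq _).symm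
  · have : IsEmpty {_i : ι n // validIdx X n} := ⟨fun i => hn i.2⟩
    rw [smoothAvg, tsum_empty, mul_zero]

theorem statement8 {ι : ℤ → Type*} [∀ n, Countable (ι n)]
    (μ : Measure X) [Nontrivial X]
    (c_mu : ℝ≥0∞) (hc1 : 1 < c_mu) (hc2 : c_mu ≠ ∞) (hdbl : IsDoubling μ c_mu)
    (hpos : ∀ (x : X) (r : ℝ), 0 < r → 0 < μ (ball x r))
    (hfin : ∀ (x : X) (r : ℝ), μ (ball x r) ≠ ∞)
    (pt : ∀ n, ι n → X) (ψ : ∀ n, ι n → X → ℝ) (κ L : ℝ)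
    (hκ : 0 < κ) (hL : 0 < L) (hpart : IsPartition pt ψ κ L)
    (c_sigma : ℝ≥0∞) (p β σ Λ : ℝ) (q : ℝ≥0∞)
    (hp : 1 < p) (hq : 1 < q) (hβ0 : 0 < β) (hβ1 : β < 1) (hΛ : 2 ≤ Λ)
    (hσ : β * p < σ) (hcσ0 : 0 < c_sigma) (hcσ1 : c_sigma ≠ ∞) (hqrd : IsQRD μ σ c_sigma) :
    ∃ C : ℝ≥0∞, 0 < C ∧ C ≠ ∞ ∧
      ∀ (x₀ : X) (r : ℝ), 0 < r →
        ∀ E : Set X, IsCompact E → E ⊆ closure (ball x₀ r) →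
          ∀ f : ℤ → X → ℝ≥0∞, IsAdmissibleSeq f →
            (∀ x ∈ E, 1 ≤ discPot μ β pt ψ f x) →
            relCap μ β p q E x₀ r Λ ≤ C * mixedNorm μ Set.univ p q f ^ p := by
  have h : DoublingFamily μ c_mu (fun n (i : {_i : ι n // validIdx X n}) => pt n i.1) :=
    { one_le := hc1.le
      ne_top := hc2
      doubling := hdbl
      pos := hpos
      fin := hfin
      disjoint := fun n i j hij => (hpart n i.2).1 i.1 j.1 fun he => hij (Subtype.ext he) }
  have hψ : IsBumpFamily (fun n (i : {_i : ι n // validIdx X n}) => pt n i.1)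
      (fun n i => ψ n i.1) L :=
    { nonneg := fun n i x => ((hpart n i.2).2.2.1 i.1 x).1
      le_one := fun n i x => ((hpart n i.2).2.2.1 i.1 x).2
      eq_zero := fun n i => (hpart n i.2).2.2.2.1 i.1
      lipschitz := fun n i x y => by
        have := ((hpart n i.2).2.2.2.2.2.1 i.1).dist_le_mul x y
        rwa [Real.dist_eq, Real.coe_toNNReal _ (by positivity), mul_comm _ L] at this }
  have hp0 : 0 < p := by linarith
  obtain ⟨C, hC, hle⟩ := h.exists_relCap_le hψ hL.le hp hq hβ0 hβ1 hσ hcσ1 hqrd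
    (fun n ⟨i⟩ => i.2) (by linarith : 0 < Λ)
  refine ⟨C + 1, by simp, ENNReal.add_ne_top.2 ⟨hC, ENNReal.one_ne_top⟩, ?_⟩
  intro x₀ r hr E hE hEB f hf hpot
  have hnorm : mixedNorm μ Set.univ p q f ^ p = ∫⁻ y, lqNorm q (fun n => f n y) ^ p ∂μ := by
    rw [mixedNorm, ← ENNReal.rpow_mul, one_div_mul_cancel hp0.ne', ENNReal.rpow_one,
      Measure.restrict_univ]
  rw [hnorm]
  by_cases hI : ∫⁻ y, lqNorm q (fun n => f n y) ^ p ∂μ = ∞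
  · rw [hI, ENNReal.mul_top (by simp)]
    exact le_top
  · refine (hle x₀ r hr E hE hEB f hf.1 hI fun x hx => ?_).trans (by gcongr; exact le_self_add)
    rw [← discPot_eq_tsum_smoothAvg]
    exact hpot x hx

end TLCap

end
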